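/- arXiv:1302.3428 — 7 statements merged into one kernel-verified Lean document; each statement's English description precedes it below -/
import Mathlib

section
/- Let S be an ω-isotropic subspace of ((ZMod 2)^n)² (i.e., ω(s,s′) = 0 for all s, s′ ∈ S) and let d, t be natural numbers with 2t < d. Suppose every element of S^⊥ \ S has weight at least d. Then for any e₁, e₂ ∈ ((ZMod 2)^n)² with wt(e₁) ≤ t, wt(e₂) ≤ t and e₁ + e₂ ∈ S^⊥ (i.e., e₁ and e₂ have the same error syndrome with respect to S), one has e₁ + e₂ ∈ S. In other words, a stabilizer code of distance d = 2t+1 corrects any t errors: any two weight-≤t errors with the same syndrome differ by a stabilizer element. -/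
namespace QEC2

/-- Pauli operators on `n` qubits, up to phase: pairs `(u,v)` with `u` the X-part
and `v` the Z-part. -/
abbrev PV (n : ℕ) := (Fin n → ZMod 2) × (Fin n → ZMod 2)

/-- The weight of `e = (u,v)`: the number of indices `i` with `(u_i, v_i) ≠ (0,0)`. -/
def wt {n : ℕ} (e : PV n) : ℕ :=
  (Finset.univ.filter fun i => e.1 i ≠ 0 ∨ e.2 i ≠ 0).card

/-- The symplectic form `ω(e,e′) = u·v′ + u′·v ∈ ZMod 2`. -/
def omg {n : ℕ} (e e' : PV n) : ZMod 2 :=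
  (∑ i, e.1 i * e'.2 i) + ∑ i, e'.1 i * e.2 i

/-- The weight is subadditive. -/
theorem wt_add_le {n : ℕ} (e e' : PV n) : wt (e + e') ≤ wt e + wt e' := by
  refine (Finset.card_le_card fun i hi => ?_).trans (Finset.card_union_le _ _)
  simp only [Finset.mem_union, Finset.mem_filter, Finset.mem_univ, true_and] at hi ⊢
  contrapose! hi
  simp [hi]

/-- A stabilizer code of distance `d = 2t+1` corrects `t` errors: if `S` is an
ω-isotropic subspace all of whose ω-orthogonal complement elements outside `S` have
weight at least `d`, and `2t < d`, then any two errors of weight at most `t` with the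
same syndrome (i.e. whose sum lies in `S^⊥`) differ by a stabilizer element. -/
theorem distance_d_corrects_t_errors (n : ℕ) (S : Submodule (ZMod 2) (PV n))
    (hiso : ∀ s ∈ S, ∀ s' ∈ S, omg s s' = 0)
    (d t : ℕ) (hdt : 2 * t < d)
    (hdist : ∀ e : PV n, (∀ s ∈ S, omg e s = 0) → e ∉ S → d ≤ wt e)
    (e₁ e₂ : PV n) (h₁ : wt e₁ ≤ t) (h₂ : wt e₂ ≤ t)
    (hsyn : ∀ s ∈ S, omg (e₁ + e₂) s = 0) :
    e₁ + e₂ ∈ S := by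
  by_contra hS
  have hd := hdist _ hsyn hS
  have hw := wt_add_le e₁ e₂
  omega

end QEC2
end

section
/- (Quantum error-correcting conditions / Knill–Laflamme.) Let P be a D × D complex matrix with P² = P and P* = P (the orthogonal projection onto the codespace), and let E : Fin m → Matrix (Fin D) (Fin D) ℂ be error operators with ∑_l (E l)* (E l) = 1. Then the following are equivalent: (i) there exist constants c : Fin m → Fin m → ℂ such that P (E k)* (E l) P = (c k l) • P for all k, l; (ii) there exist r and recovery operators R : Fin r → Matrix (Fin D) (Fin D) ℂ with ∑_j (R j)* (R j) = 1 such that for every ρ with P ρ P = ρ one has ∑_{j,l} (R j)(E l) ρ (E l)* (R j)* = ρ. -/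
namespace QEC4

open Matrix

open scoped ComplexOrder

/-- Vectors `u k` whose rank-one operators sum to the rank-one operator of `p` are all
multiples of `p`. -/
theorem exists_smul_of_sum_mul_star {κ ι : Type*} [Fintype κ] (u : κ → ι → ℂ) (p : ι → ℂ)
    (h : ∀ a b, ∑ k, u k a * star (u k b) = p a * star (p b)) :
    ∃ c : κ → ℂ, ∀ k a, u k a = c k * p a := by
  have key : ∀ v : κ → ℂ, ∑ k, v k * star (v k) = 0 → ∀ k, v k = 0 := by
    intro v hv k
    have := (Finset.sum_eq_zero_iff_of_nonneg
      (fun k _ => mul_star_self_nonneg (v k))).1 hv k (Finset.mem_univ k)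
    simpa using this
  by_cases hp : ∃ b, p b ≠ 0
  · obtain ⟨b, hb⟩ := hp
    refine ⟨fun k => u k b / p b, fun k a => ?_⟩
    have hz : u k a * p b - u k b * p a = 0 := by
      refine key (fun k => u k a * p b - u k b * p a) ?_ k
      have expand : ∀ k, (u k a * p b - u k b * p a) * star (u k a * p b - u k b * p a) =
          (u k a * star (u k a)) * (p b * star (p b)) - (u k a * star (u k b)) * (p b * star (p a))
          - (u k b * star (u k a)) * (p a * star (p b))
          + (u k b * star (u k b)) * (p a * star (p a)) := by
        intro k
        simp only [star_sub, star_mul']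
        ring
      simp only [expand, Finset.sum_add_distrib, Finset.sum_sub_distrib, ← Finset.sum_mul, h]
      ring
    field_simp
    linear_combination hz
  · push Not at hp
    refine ⟨0, fun k a => ?_⟩
    rw [hp a, mul_zero]
    exact key (fun k => u k a) (by rw [h a a, hp a, zero_mul]) k

/-- Kraus operators of a completely positive map `ρ ↦ P ρ P*` are multiples of `P`. -/
theorem exists_smul_of_sum_conj_eq {n κ : Type*} [Fintype n] [DecidableEq n] [Fintype κ]
    (A : κ → Matrix n n ℂ) (P : Matrix n n ℂ)
    (h : ∀ ρ, ∑ k, A k * ρ * (A k)ᴴ = P * ρ * Pᴴ) :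
    ∃ a : κ → ℂ, ∀ k, A k = a k • P := by
  have entry : ∀ (M : Matrix n n ℂ) (i j x y : n),
      (M * single i j (1 : ℂ) * Mᴴ) x y = M x i * star (M y j) := by
    intro M i j x y
    rw [Matrix.mul_assoc, Matrix.mul_apply]
    rw [Finset.sum_eq_single i] <;>
      simp +contextual [Matrix.mul_apply, Matrix.single_apply, eq_comm]
  obtain ⟨a, ha⟩ := exists_smul_of_sum_mul_star
    (fun k (x : n × n) => A k x.1 x.2) (fun x => P x.1 x.2) (fun x y => by
      simpa [Matrix.sum_apply, entry] using congrFun (congrFun (h (single x.2 y.2 1)) x.1) y.1)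
  exact ⟨a, fun k => Matrix.ext fun x y => ha k (x, y)⟩

/-- The recovery operators for noise in diagonal form. -/
theorem exists_recovery_of_orthogonal {n : Type*} [Fintype n] [DecidableEq n] {m : ℕ} (P : Matrix n n ℂ)
    (hproj : P * P = P) (hherm : Pᴴ = P) (F : Fin m → Matrix n n ℂ) (d : Fin m → ℝ)
    (hd : ∀ k, 0 ≤ d k) (hsum : ∑ k, d k = 1)
    (hF : ∀ k l, P * (F k)ᴴ * F l * P = if k = l then (d k : ℂ) • P else 0) :
    ∃ R : Fin (m + 1) → Matrix n n ℂ, ∑ j, (R j)ᴴ * R j = 1 ∧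
      ∀ ρ, P * ρ * P = ρ → ∑ j, ∑ l, R j * F l * ρ * (F l)ᴴ * (R j)ᴴ = ρ := by
  set s : Fin m → ℂ := fun k => ((√(d k) : ℝ) : ℂ)
  have hs : ∀ k, s k * s k = d k := fun k => by
    simp only [s, ← Complex.ofReal_mul, Real.mul_self_sqrt (hd k)]
  have hstar : ∀ k, star (s k) = s k := fun k => Complex.conj_ofReal _
  have hFzero : ∀ l, s l = 0 → F l * P = 0 := by
    intro l hl
    rw [← conjTranspose_mul_self_eq_zero, conjTranspose_mul, hherm, ← Matrix.mul_assoc, hF,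
      if_pos rfl, ← hs, hl, zero_mul, zero_smul]
  set S : Fin m → Matrix n n ℂ := fun k => (s k)⁻¹ • (P * (F k)ᴴ)
  have hSH : ∀ k, (S k)ᴴ = (s k)⁻¹ • (F k * P) := fun k => by
    simp only [S, conjTranspose_smul, conjTranspose_mul, conjTranspose_conjTranspose, hherm,
      star_inv₀, hstar]
  have hSF : ∀ k l, S k * (F l * P) = if k = l then s k • P else 0 := by
    intro k l
    simp only [S, smul_mul_assoc, ← Matrix.mul_assoc, hF]
    split_ifs with hkl
    · by_cases h0 : s k = 0
      · simp [h0]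
      · rw [smul_smul, ← hs, inv_mul_cancel_left₀ h0]
    · simp
  have hPS : ∀ k, P * S k = S k := fun k => by
    simp only [S, mul_smul_comm, ← Matrix.mul_assoc, hproj]
  have hSS : ∀ k l, S k * (S l)ᴴ * S l = if k = l then S k else 0 := by
    intro k l
    rw [hSH, Matrix.mul_smul (S k), hSF]
    split_ifs with hkl
    · subst hkl
      by_cases h0 : s k = 0
      · simp [S, h0]
      · rw [smul_smul, inv_mul_cancel₀ h0, one_smul, hPS]
    · simp
  set T : Matrix n n ℂ := ∑ k, (S k)ᴴ * S k
  have hTH : Tᴴ = T := by simp [T, conjTranspose_sum]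
  have hTT : T * T = T := by
    simp only [T, Finset.sum_mul_sum]
    refine Finset.sum_congr rfl fun k _ => ?_
    simp [Matrix.mul_assoc, ← Matrix.mul_assoc (S k), hSS]
  have hTF : ∀ l, T * (F l * P) = F l * P := by
    intro l
    simp only [T, Finset.sum_mul, Matrix.mul_assoc, hSF]
    by_cases h0 : s l = 0
    · simp [hFzero l h0, h0]
    · simp [hSH, Matrix.mul_assoc, hproj, smul_smul, h0]
  refine ⟨Fin.cons (1 - T) S, ?_, fun ρ hρ => ?_⟩
  · rw [Fin.sum_univ_succ]
    simp only [Fin.cons_zero, Fin.cons_succ]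
    change _ + T = 1
    rw [conjTranspose_sub, hTH, conjTranspose_one, Matrix.sub_mul, one_mul, Matrix.mul_sub, mul_one, hTT]
    simp
  · have hconj : ∀ X Y : Matrix n n ℂ,
        X * Y * ρ * Yᴴ * Xᴴ = (X * (Y * P)) * ρ * (X * (Y * P))ᴴ := by
      intro X Y
      conv_lhs => rw [← hρ]
      simp only [conjTranspose_mul, hherm, Matrix.mul_assoc]
    have hPρ : P * ρ * Pᴴ = ρ := by rw [hherm, hρ]
    rw [Fin.sum_univ_succ]
    have hQF : ∀ l, (1 - T) * (F l * P) = 0 := fun l => by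
      rw [Matrix.sub_mul, hTF, one_mul, sub_self]
    simp only [Fin.cons_zero, Fin.cons_succ, hconj, hQF, hSF, zero_mul, Finset.sum_const_zero,
      zero_add]
    have hterm : ∀ k l, (if k = l then s k • P else 0) * ρ * (if k = l then s k • P else 0)ᴴ =
        if k = l then (d k : ℂ) • ρ else 0 := by
      intro k l
      split_ifs
      · rw [conjTranspose_smul, hstar, smul_mul_assoc, smul_mul_assoc, mul_smul_comm, hPρ,
          smul_smul, hs]
      · simp
    simp only [hterm, Finset.sum_ite_eq, Finset.mem_univ, if_true, ← Finset.sum_smul,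
      ← Complex.ofReal_sum, hsum, Complex.ofReal_one, one_smul]

/-- Mixing Kraus operators by a unitary matrix leaves the channel unchanged. -/
theorem sum_conj_unitary_mix {n κ : Type*} [Fintype n] [Fintype κ] [DecidableEq κ]
    (U : Matrix κ κ ℂ) (hU : U * Uᴴ = 1)
    (E : κ → Matrix n n ℂ) (ρ : Matrix n n ℂ) :
    ∑ l, (∑ k, U k l • E k) * ρ * (∑ k, U k l • E k)ᴴ = ∑ l, E l * ρ * (E l)ᴴ := by
  have hent : ∀ k k', ∑ l, U k l * star (U k' l) = if k = k' then 1 else 0 := fun k k' => by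
    simpa [Matrix.mul_apply, Matrix.one_apply] using congrFun (congrFun hU k) k'
  calc _ = ∑ l, ∑ k', ∑ k, (U k l * star (U k' l)) • (E k * ρ * (E k')ᴴ) := by
        simp only [conjTranspose_sum, conjTranspose_smul, Finset.sum_mul, Finset.mul_sum,
          Matrix.smul_mul, Matrix.mul_smul, smul_smul, mul_comm]
    _ = ∑ k', ∑ k, (∑ l, U k l * star (U k' l)) • (E k * ρ * (E k')ᴴ) := by
        rw [Finset.sum_comm]
        refine Finset.sum_congr rfl fun k' _ => ?_
        rw [Finset.sum_comm]
        simp only [Finset.sum_smul]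
    _ = _ := by simp only [hent, ite_smul, one_smul, zero_smul, Finset.sum_ite_eq',
          Finset.mem_univ, if_true]

/-- Knill–Laflamme quantum error-correcting conditions: for a codespace projection `P`
and noise Kraus operators `E l` with `∑ l, (E l)* (E l) = 1`, the existence of constants
`c k l` with `P (E k)* (E l) P = c k l • P` is equivalent to the existence of a recovery
operation `{R j}` (Kraus operators with `∑ j, (R j)* (R j) = 1`) such that recovery
composed with the noise is the identity on every `ρ` supported on the codespace. -/
theorem knill_laflamme (D m : ℕ) (P : Matrix (Fin D) (Fin D) ℂ)
    (hproj : P * P = P) (hherm : Pᴴ = P)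
    (E : Fin m → Matrix (Fin D) (Fin D) ℂ)
    (hE : ∑ l, (E l)ᴴ * E l = 1) :
    (∃ c : Fin m → Fin m → ℂ, ∀ k l, P * (E k)ᴴ * E l * P = c k l • P) ↔
      (∃ (r : ℕ) (R : Fin r → Matrix (Fin D) (Fin D) ℂ),
        (∑ j, (R j)ᴴ * R j = 1) ∧
        ∀ ρ : Matrix (Fin D) (Fin D) ℂ, P * ρ * P = ρ →
          ∑ j, ∑ l, R j * E l * ρ * (E l)ᴴ * (R j)ᴴ = ρ) := by
  constructor
  · rintro ⟨c, hc⟩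
    by_cases hP : P = 0
    · refine ⟨1, fun _ => 1, by simp, fun ρ hρ => ?_⟩
      have : ρ = 0 := by rw [← hρ, hP]; simp
      simp [this]
    have hinj : ∀ {a b : ℂ}, a • P = b • P → a = b := fun h => smul_left_injective ℂ hP h
    have hcH : (Matrix.of c).IsHermitian := by
      refine Matrix.ext fun k l => hinj ?_
      change star (c l k) • P = c k l • P
      rw [← hc k l]
      nth_rw 1 [← hherm]
      rw [← conjTranspose_smul, ← hc l k]
      simp only [conjTranspose_mul, conjTranspose_conjTranspose, hherm, Matrix.mul_assoc]
    set U : Matrix (Fin m) (Fin m) ℂ := hcH.eigenvectorUnitary.1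
    set d := hcH.eigenvalues
    have hUU : U * Uᴴ = 1 := Unitary.coe_mul_star_self hcH.eigenvectorUnitary
    have hdiag : Uᴴ * Matrix.of c * U = diagonal (fun k => (d k : ℂ)) := by
      have h := hcH.conjStarAlgAut_star_eigenvectorUnitary
      rwa [Unitary.conjStarAlgAut_star_apply] at h
    set F : Fin m → Matrix (Fin D) (Fin D) ℂ := fun l => ∑ k, U k l • E k
    have hF : ∀ k l, P * (F k)ᴴ * F l * P = if k = l then (d k : ℂ) • P else 0 := by
      intro k l
      have h1 : P * (F k)ᴴ * F l * P = (Uᴴ * Matrix.of c * U) k l • P := by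
        simp only [F, conjTranspose_sum, conjTranspose_smul, Finset.sum_mul, Finset.mul_sum,
          Matrix.smul_mul, Matrix.mul_smul, smul_smul, hc, Matrix.mul_apply, Finset.sum_smul,
          conjTranspose_apply, Matrix.of_apply]
        refine Finset.sum_congr rfl fun i _ => Finset.sum_congr rfl fun j _ => ?_
        congr 1
        ring
      rw [h1, hdiag, diagonal_apply, ite_smul, zero_smul]
    have htr : 0 < P.trace := by
      have hpos : 0 ≤ (Pᴴ * P).trace := (posSemidef_conjTranspose_mul_self P).trace_nonneg
      have hne : (Pᴴ * P).trace ≠ 0 := fun h => hP (trace_conjTranspose_mul_self_eq_zero_iff.1 h)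
      rw [hherm, hproj] at hpos hne
      exact lt_of_le_of_ne hpos hne.symm
    have hd : ∀ k, 0 ≤ d k := by
      intro k
      have h1 := (posSemidef_conjTranspose_mul_self (F k * P)).trace_nonneg
      rw [conjTranspose_mul, hherm, ← Matrix.mul_assoc, hF, if_pos rfl, trace_smul,
        smul_eq_mul] at h1
      have h2 := (Complex.nonneg_iff.1 h1).1
      rw [Complex.re_ofReal_mul] at h2
      exact nonneg_of_mul_nonneg_left h2 (Complex.pos_iff.1 htr).1
    have hsum : ∑ k, d k = 1 := by
      have h1 : (∑ k, c k k) = 1 := hinj (by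
        simp only [Finset.sum_smul, ← hc, one_smul, ← Finset.sum_mul, Matrix.mul_assoc P,
          ← Finset.mul_sum, hE, one_mul, hproj])
      have h2 := hcH.trace_eq_sum_eigenvalues
      have h3 : (Matrix.of c).trace = 1 := h1
      rw [h3] at h2
      exact Complex.ofReal_injective (by push_cast; exact h2.symm)
    obtain ⟨R, hR, hrec⟩ := exists_recovery_of_orthogonal P hproj hherm F d hd hsum hF
    refine ⟨m + 1, R, hR, fun ρ hρ => ?_⟩
    have h1 : ∀ (X : Matrix (Fin D) (Fin D) ℂ) (G : Fin m → Matrix (Fin D) (Fin D) ℂ),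
        ∑ l, X * G l * ρ * (G l)ᴴ * Xᴴ = X * (∑ l, G l * ρ * (G l)ᴴ) * Xᴴ := by
      intro X G
      simp only [Finset.mul_sum, Finset.sum_mul, Matrix.mul_assoc]
    have h2 := hrec ρ hρ
    simp only [h1, F, sum_conj_unitary_mix U hUU] at h2
    simp only [h1, h2]
  · rintro ⟨r, R, hR, hrec⟩
    obtain ⟨a, ha⟩ := exists_smul_of_sum_conj_eq
      (fun x : Fin r × Fin m => R x.1 * E x.2 * P) P (fun ρ => by
        rw [hherm, ← hrec (P * ρ * P) (by
          simp only [← Matrix.mul_assoc, hproj]; rw [Matrix.mul_assoc _ P P, hproj]),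
          Fintype.sum_prod_type]
        simp only [conjTranspose_mul, hherm, Matrix.mul_assoc])
    refine ⟨fun k l => ∑ j, star (a (j, k)) * a (j, l), fun k l => ?_⟩
    calc P * (E k)ᴴ * E l * P = P * (E k)ᴴ * (∑ j, (R j)ᴴ * R j) * E l * P := by
          rw [hR, mul_one]
      _ = ∑ j, (R j * E k * P)ᴴ * (R j * E l * P) := by
          simp only [Finset.mul_sum, Finset.sum_mul, conjTranspose_mul, hherm, Matrix.mul_assoc]
      _ = _ := by
          rw [Finset.sum_smul]
          refine Finset.sum_congr rfl fun j _ => ?_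
          rw [show R j * E k * P = _ from ha (j, k), show R j * E l * P = _ from ha (j, l),
            conjTranspose_smul, hherm, smul_mul_assoc, mul_smul_comm, hproj, smul_smul]

end QEC4
end

section
/- Let S ⊆ ((ZMod 2)^{12})² be the span of the 10 parity check vectors of the code obtained by concatenating the code C₆ with the code C₄ = [[4,2,2]]: the X-type vectors with u-supports {1,2,3,4}, {5,6,7,8}, {9,10,11,12}, {1,2,6,8,9,12}, {1,4,5,6,10,12} (and v = 0), and the Z-type vectors with v-supports {1,2,3,4}, {5,6,7,8}, {9,10,11,12}, {1,3,7,8,9,12}, {1,4,5,7,11,12} (and u = 0). Then: (a) these 10 vectors are linearly independent and S is ω-isotropic, so the code encodes 12 − 10 = 2 qubits; (b) the minimum weight of an element of S^⊥ \ S equals 4. Hence this is a [[12,2,4]] code, able to correct any single-qubit error and detect any three errors. -/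
namespace QEC7

/-- Pauli operators on `n` qubits, up to phase: pairs `(u,v)` with `u` the X-part
and `v` the Z-part. -/
abbrev PV (n : ℕ) := (Fin n → ZMod 2) × (Fin n → ZMod 2)

/-- The weight of `e = (u,v)`: the number of indices `i` with `(u_i, v_i) ≠ (0,0)`. -/
def wt {n : ℕ} (e : PV n) : ℕ :=
  (Finset.univ.filter fun i => e.1 i ≠ 0 ∨ e.2 i ≠ 0).card

/-- The symplectic form `ω(e,e′) = u·v′ + u′·v ∈ ZMod 2`. -/
def omg {n : ℕ} (e e' : PV n) : ZMod 2 :=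
  (∑ i, e.1 i * e'.2 i) + ∑ i, e'.1 i * e.2 i

/-- The 10 parity check vectors of the concatenation of `C₆` with `C₄ = [[4,2,2]]`
(qubits indexed `0,…,11`; the 1-based supports of the statement are shifted by one):
X-type supports `{1,2,3,4}, {5,6,7,8}, {9,10,11,12}, {1,2,6,8,9,12}, {1,4,5,6,10,12}`
and Z-type supports `{1,2,3,4}, {5,6,7,8}, {9,10,11,12}, {1,3,7,8,9,12}, {1,4,5,7,11,12}`. -/
def c6c4Checks : Fin 10 → PV 12 :=
  ![ (![1,1,1,1, 0,0,0,0, 0,0,0,0], 0),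
     (![0,0,0,0, 1,1,1,1, 0,0,0,0], 0),
     (![0,0,0,0, 0,0,0,0, 1,1,1,1], 0),
     (![1,1,0,0, 0,1,0,1, 1,0,0,1], 0),
     (![1,0,0,1, 1,1,0,0, 0,1,0,1], 0),
     (0, ![1,1,1,1, 0,0,0,0, 0,0,0,0]),
     (0, ![0,0,0,0, 1,1,1,1, 0,0,0,0]),
     (0, ![0,0,0,0, 0,0,0,0, 1,1,1,1]),
     (0, ![1,0,1,0, 0,0,1,1, 1,0,0,1]),
     (0, ![1,0,0,1, 1,0,1,0, 0,0,1,1]) ]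

/-- The stabilizer: the span of the 10 parity checks. -/
def c6c4S : Submodule (ZMod 2) (PV 12) :=
  Submodule.span (ZMod 2) (Set.range c6c4Checks)

lemma omg_comm {n : ℕ} (e e' : PV n) : omg e e' = omg e' e :=
  add_comm _ _

lemma omg_add_right {n : ℕ} (e x y : PV n) : omg e (x + y) = omg e x + omg e y := by
  simp only [omg, Prod.fst_add, Prod.snd_add, Pi.add_apply, mul_add, add_mul,
    Finset.sum_add_distrib]
  ring

lemma omg_smul_right {n : ℕ} (a : ZMod 2) (e x : PV n) : omg e (a • x) = a * omg e x := by
  simp only [omg, Prod.smul_fst, Prod.smul_snd, Pi.smul_apply, smul_eq_mul, mul_add,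
    Finset.mul_sum, mul_assoc, mul_left_comm]

/-- A vector commutes with a span as soon as it commutes with the generators. -/
lemma omg_eq_zero_of_mem_span {n : ℕ} {ι : Type*} {g : ι → PV n} {e : PV n}
    (h : ∀ i, omg e (g i) = 0) {s : PV n} (hs : s ∈ Submodule.span (ZMod 2) (Set.range g)) :
    omg e s = 0 := by
  induction hs using Submodule.span_induction with
  | mem x hx => obtain ⟨i, rfl⟩ := hx; exact h i
  | zero => simp [omg]
  | add x y _ _ hx hy => rw [omg_add_right, hx, hy, add_zero]
  | smul a x _ hx => rw [omg_smul_right, hx, mul_zero]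

lemma card_fst_le_wt {n : ℕ} (e : PV n) :
    (Finset.univ.filter fun i => e.1 i ≠ 0).card ≤ wt e :=
  Finset.card_le_card (Finset.monotone_filter_right _ fun _ _ h => Or.inl h)

lemma card_snd_le_wt {n : ℕ} (e : PV n) :
    (Finset.univ.filter fun i => e.2 i ≠ 0).card ≤ wt e :=
  Finset.card_le_card (Finset.monotone_filter_right _ fun _ _ h => Or.inr h)

lemma c6c4Checks_linearIndependent : LinearIndependent (ZMod 2) c6c4Checks := by
  rw [Fintype.linearIndependent_iff]
  intro g hg
  have hX (k : Fin 12) : ∑ i, g i * (c6c4Checks i).1 k = 0 := by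
    simpa [Prod.fst_sum, Finset.sum_apply] using congrArg (fun e : PV 12 => e.1 k) hg
  have hZ (k : Fin 12) : ∑ i, g i * (c6c4Checks i).2 k = 0 := by
    simpa [Prod.snd_sum, Finset.sum_apply] using congrArg (fun e : PV 12 => e.2 k) hg
  have h0 : g 0 = 0 := by simpa [Fin.sum_univ_succ, c6c4Checks] using hX 2
  have h1 : g 1 = 0 := by simpa [Fin.sum_univ_succ, c6c4Checks] using hX 6
  have h2 : g 2 = 0 := by simpa [Fin.sum_univ_succ, c6c4Checks] using hX 10
  have h3 : g 3 = 0 := by simpa [Fin.sum_univ_succ, c6c4Checks, h0] using hX 1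
  have h4 : g 4 = 0 := by simpa [Fin.sum_univ_succ, c6c4Checks, h1] using hX 4
  have h5 : g 5 = 0 := by simpa [Fin.sum_univ_succ, c6c4Checks] using hZ 1
  have h6 : g 6 = 0 := by simpa [Fin.sum_univ_succ, c6c4Checks] using hZ 5
  have h7 : g 7 = 0 := by simpa [Fin.sum_univ_succ, c6c4Checks] using hZ 9
  have h8 : g 8 = 0 := by simpa [Fin.sum_univ_succ, c6c4Checks, h5] using hZ 2
  have h9 : g 9 = 0 := by simpa [Fin.sum_univ_succ, c6c4Checks, h6] using hZ 4
  intro i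
  fin_cases i <;> assumption

lemma omg_c6c4Checks (i j : Fin 10) : omg (c6c4Checks i) (c6c4Checks j) = 0 := by
  revert i j
  decide +kernel

/-- An even-weight vector on one block of `C₄` vanishes, or has weight 4, or has weight 2 and
a nonzero syndrome with respect to the checks inherited from `C₆`. -/
lemma block_eq_zero_or_le : ∀ a b c d : ZMod 2, a + b + c + d = 0 →
    (a = 0 ∧ b = 0 ∧ c = 0 ∧ d = 0) ∨ 4 ≤ a.val + b.val + c.val + d.val ∨
      (2 ≤ a.val + b.val + c.val + d.val ∧ (a + c ≠ 0 ∨ a + d ≠ 0)) := by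
  decide

/-- The checks of one type have no nonzero codeword of weight at most 3; the support is split into
the three blocks of `C₄`. Exchanging the two middle qubits of each block turns the Z-checks
considered here into the X-checks. -/
lemma bits_eq_zero_of_blocks (a b c d : ZMod 2) (h₁ : a + b + c + d = 0)
    (e f g h : ZMod 2) (h₂ : e + f + g + h = 0) (i j k l : ZMod 2) (h₃ : i + j + k + l = 0)
    (h₄ : a + c + g + h + i + l = 0) (h₅ : a + d + e + g + k + l = 0)
    (hwt : a.val + b.val + c.val + d.val + e.val + f.val + g.val + h.val +
      i.val + j.val + k.val + l.val < 4) :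
    a = 0 ∧ b = 0 ∧ c = 0 ∧ d = 0 ∧ e = 0 ∧ f = 0 ∧ g = 0 ∧ h = 0 ∧
      i = 0 ∧ j = 0 ∧ k = 0 ∧ l = 0 := by
  have hb₁ := block_eq_zero_or_le a b c d h₁
  have hb₂ := block_eq_zero_or_le g f h e (by linear_combination h₂)
  have hb₃ := block_eq_zero_or_le l j i k (by linear_combination h₃)
  rcases hb₁ with hb₁ | hb₁ | hb₁ <;> rcases hb₂ with hb₂ | hb₂ | hb₂ <;>
    rcases hb₃ with hb₃ | hb₃ | hb₃ <;> first | omega | grind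

lemma card_support_eq_sum_val {n : ℕ} (u : Fin n → ZMod 2) :
    (Finset.univ.filter fun i => u i ≠ 0).card = ∑ i, (u i).val := by
  have hval : ∀ a : ZMod 2, (if a ≠ 0 then 1 else 0) = a.val := by decide
  simp only [Finset.card_filter, hval]

/-- A pure X-type vector of weight less than 4 commuting with all checks is zero. -/
lemma eq_zero_of_xType {u : Fin 12 → ZMod 2}
    (hcard : (Finset.univ.filter fun i => u i ≠ 0).card < 4)
    (h : ∀ j, omg (u, 0) (c6c4Checks j) = 0) : u = 0 := by
  have h0 := h 5
  have h1 := h 6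
  have h2 := h 7
  have h3 := h 8
  have h4 := h 9
  rw [card_support_eq_sum_val] at hcard
  simp [omg, c6c4Checks, Fin.sum_univ_succ] at h0 h1 h2 h3 h4 hcard
  have key := bits_eq_zero_of_blocks
    (u 0) (u 1) (u 2) (u 3) (by linear_combination h0)
    (u 4) (u 5) (u 6) (u 7) (by linear_combination h1)
    (u 8) (u 9) (u 10) (u 11) (by linear_combination h2)
    (by linear_combination h3) (by linear_combination h4) (by omega)
  funext i
  fin_cases i <;> simp [key]

/-- A pure Z-type vector of weight less than 4 commuting with all checks is zero. -/
lemma eq_zero_of_zType {v : Fin 12 → ZMod 2}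
    (hcard : (Finset.univ.filter fun i => v i ≠ 0).card < 4)
    (h : ∀ j, omg (0, v) (c6c4Checks j) = 0) : v = 0 := by
  have h0 := h 0
  have h1 := h 1
  have h2 := h 2
  have h3 := h 3
  have h4 := h 4
  rw [card_support_eq_sum_val] at hcard
  simp [omg, c6c4Checks, Fin.sum_univ_succ] at h0 h1 h2 h3 h4 hcard
  have key := bits_eq_zero_of_blocks
    (v 0) (v 2) (v 1) (v 3) (by linear_combination h0)
    (v 4) (v 6) (v 5) (v 7) (by linear_combination h1)
    (v 8) (v 10) (v 9) (v 11) (by linear_combination h2)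
    (by linear_combination h3) (by linear_combination h4) (by omega)
  funext i
  fin_cases i <;> simp [key]

/-- Each check is of pure X- or Z-type, so the two parts of a vector commuting with all checks
commute with them separately. -/
lemma omg_parts_c6c4Checks {e : PV 12} (h : ∀ j, omg e (c6c4Checks j) = 0) (j : Fin 10) :
    omg (e.1, 0) (c6c4Checks j) = 0 ∧ omg (0, e.2) (c6c4Checks j) = 0 := by
  have hpure : (c6c4Checks j).1 = 0 ∨ (c6c4Checks j).2 = 0 := by
    clear h
    revert j
    decide +kernel
  have hj := h j
  rcases hpure with h0 | h0 <;> simp_all [omg]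

/-- The logical X-type operator supported on `{1,2,5,8}`. -/
def c6c4LogicalX : PV 12 := (![1,1,0,0, 1,0,0,1, 0,0,0,0], 0)

/-- A logical Z-type operator, supported on `{1,3,9,10}`, anticommuting with `c6c4LogicalX`. -/
def c6c4LogicalZ : PV 12 := (0, ![1,0,1,0, 0,0,0,0, 1,1,0,0])

lemma c6c4LogicalX_not_mem : c6c4LogicalX ∉ c6c4S := fun h =>
  absurd (omg_eq_zero_of_mem_span (e := c6c4LogicalZ) (by decide +kernel) h) (by decide +kernel)

/-- The concatenation of `C₆` with `C₄ = [[4,2,2]]` is a `[[12,2,4]]` code: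
(a) the 10 checks are linearly independent and the stabilizer is ω-isotropic, so the code
encodes `12 − 10 = 2` qubits; (b) the minimum weight of an element of `S^⊥ \ S` equals 4,
so it corrects any single-qubit error and detects any three errors. -/
theorem c6c4_code_is_12_2_4 :
    (LinearIndependent (ZMod 2) c6c4Checks ∧
      ∀ s ∈ c6c4S, ∀ s' ∈ c6c4S, omg s s' = 0) ∧
    IsLeast {w : ℕ | ∃ e : PV 12, (∀ s ∈ c6c4S, omg e s = 0) ∧ e ∉ c6c4S ∧ wt e = w} 4 := by
  refine ⟨⟨c6c4Checks_linearIndependent, fun s hs s' hs' => ?_⟩, ?_, ?_⟩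
  · refine omg_eq_zero_of_mem_span (fun i => ?_) hs'
    rw [omg_comm]
    exact omg_eq_zero_of_mem_span (omg_c6c4Checks i) hs
  · exact ⟨c6c4LogicalX, fun s hs => omg_eq_zero_of_mem_span (by decide +kernel) hs,
      c6c4LogicalX_not_mem, by decide +kernel⟩
  · rintro _ ⟨e, he, hne, rfl⟩
    by_contra! hlt
    have hparts := omg_parts_c6c4Checks fun j => he _ (Submodule.subset_span ⟨j, rfl⟩)
    have hu := eq_zero_of_xType ((card_fst_le_wt e).trans_lt hlt)
      (fun j => (hparts j).1)
    have hv := eq_zero_of_zType ((card_snd_le_wt e).trans_lt hlt)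
      (fun j => (hparts j).2)
    obtain rfl : e = 0 := Prod.ext hu hv
    exact hne c6c4S.zero_mem

end QEC7
end

section
/- Let S ⊆ ((ZMod 2)^7)² be the span of the 6 parity check vectors of Steane's code: the Z-type vectors with v-supports {4,5,6,7}, {2,3,6,7}, {1,3,5,7} (and u = 0), and the X-type vectors with u-supports {4,5,6,7}, {2,3,6,7}, {1,3,5,7} (and v = 0). Then: (a) these 6 vectors are linearly independent and S is ω-isotropic (all checks commute), so the code encodes 7 − 6 = 1 qubit; (b) the minimum weight of an element of S^⊥ \ S equals 3. Hence Steane's code is a [[7,1,3]] code which corrects any single-qubit error. -/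
namespace QEC9

/-- Pauli operators on `n` qubits, up to phase: pairs `(u,v)` with `u` the X-part
and `v` the Z-part. -/
abbrev PV (n : ℕ) := (Fin n → ZMod 2) × (Fin n → ZMod 2)

/-- The weight of `e = (u,v)`: the number of indices `i` with `(u_i, v_i) ≠ (0,0)`. -/
def wt {n : ℕ} (e : PV n) : ℕ :=
  (Finset.univ.filter fun i => e.1 i ≠ 0 ∨ e.2 i ≠ 0).card

/-- The symplectic form `ω(e,e′) = u·v′ + u′·v ∈ ZMod 2`. -/
def omg {n : ℕ} (e e' : PV n) : ZMod 2 :=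
  (∑ i, e.1 i * e'.2 i) + ∑ i, e'.1 i * e.2 i

/-- The 6 parity check vectors of Steane's code (qubits indexed `0,…,6`): Z-type checks
with supports `{4,5,6,7}, {2,3,6,7}, {1,3,5,7}` (1-based) and X-type checks with the
same supports. -/
def steaneChecks : Fin 6 → PV 7 :=
  ![ (0, ![0,0,0,1,1,1,1]),
     (0, ![0,1,1,0,0,1,1]),
     (0, ![1,0,1,0,1,0,1]),
     (![0,0,0,1,1,1,1], 0),
     (![0,1,1,0,0,1,1], 0),
     (![1,0,1,0,1,0,1], 0) ]

/-- The stabilizer of Steane's code: the span of its 6 parity checks. -/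
def steaneS : Submodule (ZMod 2) (PV 7) :=
  Submodule.span (ZMod 2) (Set.range steaneChecks)

/-- The symplectic form as a linear map in its second argument. -/
def omgLin {n : ℕ} (e : PV n) : PV n →ₗ[ZMod 2] ZMod 2 where
  toFun := omg e
  map_add' x y := by
    simp only [omg, Prod.fst_add, Prod.snd_add, Pi.add_apply, mul_add, add_mul,
      Finset.sum_add_distrib]
    ring
  map_smul' c x := by
    simp only [omg, Prod.smul_fst, Prod.smul_snd, Pi.smul_apply, smul_eq_mul, RingHom.id_apply,
      mul_add, Finset.mul_sum]
    congr 1 <;> exact Finset.sum_congr rfl fun i _ => by ring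

theorem omg_comm {n : ℕ} (e e' : PV n) : omg e e' = omg e' e := add_comm _ _

/-- A vector commutes with the stabilizer as soon as it commutes with the six checks. -/
theorem omg_eq_zero_of_checks {e : PV 7} (h : ∀ i, omg e (steaneChecks i) = 0) :
    ∀ s ∈ steaneS, omg e s = 0 := by
  have hle : steaneS ≤ LinearMap.ker (omgLin e) := by
    refine Submodule.span_le.2 ?_
    rintro _ ⟨i, rfl⟩
    exact h i
  exact fun s hs => hle hs

theorem steaneChecks_mem (i : Fin 6) : steaneChecks i ∈ steaneS :=
  Submodule.subset_span ⟨i, rfl⟩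

theorem linearIndependent_steaneChecks : LinearIndependent (ZMod 2) steaneChecks := by
  rw [Fintype.linearIndependent_iff]
  intro g hg
  have hu (j : Fin 7) := congrFun (congrArg Prod.fst hg) j
  have hv (j : Fin 7) := congrFun (congrArg Prod.snd hg) j
  simp only [Fin.sum_univ_six, steaneChecks] at hu hv
  have h0 := hv 3
  have h1 := hv 1
  have h2 := hv 0
  have h3 := hu 3
  have h4 := hu 1
  have h5 := hu 0
  simp at h0 h1 h2 h3 h4 h5
  intro i
  fin_cases i <;> assumption

/-- The stabilizer of Steane's code is isotropic. -/
theorem omg_eq_zero_of_mem_steaneS : ∀ s ∈ steaneS, ∀ s' ∈ steaneS, omg s s' = 0 := by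
  intro s hs
  refine omg_eq_zero_of_checks fun i => ?_
  rw [omg_comm]
  refine omg_eq_zero_of_checks (fun j => ?_) s hs
  revert i j
  decide +kernel

/-- The Hamming code, the kernel of the common support matrix of the X- and Z-checks,
has minimum distance at least 3. -/
theorem eq_zero_of_hamming_checks : ∀ x : Fin 7 → ZMod 2,
    x 3 + x 4 + x 5 + x 6 = 0 → x 1 + x 2 + x 5 + x 6 = 0 → x 0 + x 2 + x 4 + x 6 = 0 →
    (Finset.univ.filter fun i => x i ≠ 0).card < 3 → x = 0 := by
  decide +kernel

theorem three_le_wt {e : PV 7} (h : ∀ i, omg e (steaneChecks i) = 0) (he : e ≠ 0) :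
    3 ≤ wt e := by
  by_contra! hlt
  have h0 := h 0
  have h1 := h 1
  have h2 := h 2
  have h3 := h 3
  have h4 := h 4
  have h5 := h 5
  simp [omg, steaneChecks, Fin.sum_univ_seven] at h0 h1 h2 h3 h4 h5
  refine he (Prod.ext (eq_zero_of_hamming_checks e.1 h0 h1 h2 (lt_of_le_of_lt ?_ hlt))
    (eq_zero_of_hamming_checks e.2 h3 h4 h5 (lt_of_le_of_lt ?_ hlt)))
  · exact Finset.card_le_card (Finset.monotone_filter_right _ fun _ _ => Or.inl)
  · exact Finset.card_le_card (Finset.monotone_filter_right _ fun _ _ => Or.inr)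

/-- A weight 3 representative of the logical Z operator. -/
def logicalZ : PV 7 := (0, ![1,1,1,0,0,0,0])

theorem logicalZ_notMem : logicalZ ∉ steaneS := by
  intro hmem
  have hX : omg ((fun _ => 1, 0) : PV 7) logicalZ = 0 :=
    omg_eq_zero_of_checks (by decide +kernel) _ hmem
  exact absurd hX (by decide +kernel)

/-- Steane's code is a `[[7,1,3]]` code: (a) its 6 checks are linearly independent and
the stabilizer is ω-isotropic (all checks commute), so it encodes `7 − 6 = 1` qubit;
(b) the minimum weight of an element of `S^⊥ \ S` equals 3, so it corrects any
single-qubit error. -/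
theorem steane_code_is_7_1_3 :
    (LinearIndependent (ZMod 2) steaneChecks ∧
      ∀ s ∈ steaneS, ∀ s' ∈ steaneS, omg s s' = 0) ∧
    IsLeast {w : ℕ | ∃ e : PV 7, (∀ s ∈ steaneS, omg e s = 0) ∧ e ∉ steaneS ∧ wt e = w} 3 := by
  refine ⟨⟨linearIndependent_steaneChecks, omg_eq_zero_of_mem_steaneS⟩, ?_, ?_⟩
  · exact ⟨logicalZ, omg_eq_zero_of_checks (by decide +kernel), logicalZ_notMem,
      by decide +kernel⟩
  · rintro _ ⟨e, hcomm, hnot, rfl⟩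
    exact three_le_wt (fun i => hcomm _ (steaneChecks_mem i))
      fun h => hnot (h ▸ steaneS.zero_mem)

end QEC9
end

section
/- (Surface code: checks commute and logical operators realize a qubit.) Fix L ≥ 2 and consider the surface code on n = L² + (L−1)² qubits indexed by Q = A ∪ B with A = {a(i,j) : 1 ≤ i,j ≤ L} (vertical edges) and B = {b(i,j) : 1 ≤ i,j ≤ L−1} (horizontal edges). The star (X-type) check s(i,j), for 1 ≤ i ≤ L−1, 1 ≤ j ≤ L, has u-support {a(i,j), a(i+1,j)} ∪ {b(i,j−1) : j ≥ 2} ∪ {b(i,j) : j ≤ L−1}; the plaquette (Z-type) check p(i,j), for 1 ≤ i ≤ L, 1 ≤ j ≤ L−1, has v-support {a(i,j), a(i,j+1)} ∪ {b(i−1,j) : i ≥ 2} ∪ {b(i,j) : i ≤ L−1}. Let S ⊆ ((ZMod 2)^Q)² be the span of all these check vectors, and let Z̄ be the Z-type vector supported on the column {a(i,j₀) : 1 ≤ i ≤ L} (any fixed j₀) and X̄ the X-type vector supported on the row {a(i₀,j) : 1 ≤ j ≤ L} (any fixed i₀). Then: (a) ω(s, p) = 0 for every star s and plaquette p, so S is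 ω-isotropic (all checks commute); (b) Z̄ ∈ S^⊥ and X̄ ∈ S^⊥ (the logical operators commute with all checks); (c) ω(Z̄, X̄) = 1 (the logical operators anticommute); (d) Z̄ ∉ S and X̄ ∉ S, and both have weight L. -/
namespace QEC17

/-- The qubits of the `L × L` surface code: `A = Fin L × Fin L` (vertical edges, 0-based
indexing of the `1 ≤ i,j ≤ L` of the statement) and `B = Fin (L-1) × Fin (L-1)`
(horizontal edges). -/
abbrev Qbit (L : ℕ) := (Fin L × Fin L) ⊕ (Fin (L - 1) × Fin (L - 1))

/-- Pauli operators up to phase on the surface-code qubits: pairs `(u,v)` with `u` the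
X-part and `v` the Z-part. -/
abbrev PV (L : ℕ) := (Qbit L → ZMod 2) × (Qbit L → ZMod 2)

/-- The weight of `e = (u,v)`: the number of qubits `q` with `(u_q, v_q) ≠ (0,0)`. -/
def wt {L : ℕ} (e : PV L) : ℕ :=
  (Finset.univ.filter fun q => e.1 q ≠ 0 ∨ e.2 q ≠ 0).card

/-- The symplectic form `ω(e,e′) = u·v′ + u′·v ∈ ZMod 2`. -/
def omg {L : ℕ} (e e' : PV L) : ZMod 2 :=
  (∑ q, e.1 q * e'.2 q) + ∑ q, e'.1 q * e.2 q

/-- The star (X-type) check `s(i,j)` (`1 ≤ i ≤ L−1`, `1 ≤ j ≤ L`, here 0-based), with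
u-support `{a(i,j), a(i+1,j)} ∪ {b(i,j−1) : j ≥ 2} ∪ {b(i,j) : j ≤ L−1}`. -/
def starCheck (L : ℕ) (i : Fin (L - 1)) (j : Fin L) : PV L :=
  (fun q => match q with
    | Sum.inl (i', j') =>
        if (i'.val = i.val ∨ i'.val = i.val + 1) ∧ j' = j then 1 else 0
    | Sum.inr (i', j') =>
        if i'.val = i.val ∧ (j'.val + 1 = j.val ∨ j'.val = j.val) then 1 else 0,
   0)

/-- The plaquette (Z-type) check `p(i,j)` (`1 ≤ i ≤ L`, `1 ≤ j ≤ L−1`, here 0-based), with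
v-support `{a(i,j), a(i,j+1)} ∪ {b(i−1,j) : i ≥ 2} ∪ {b(i,j) : i ≤ L−1}`. -/
def plaqCheck (L : ℕ) (i : Fin L) (j : Fin (L - 1)) : PV L :=
  (0,
   fun q => match q with
    | Sum.inl (i', j') =>
        if i' = i ∧ (j'.val = j.val ∨ j'.val = j.val + 1) then 1 else 0
    | Sum.inr (i', j') =>
        if (i'.val + 1 = i.val ∨ i'.val = i.val) ∧ j'.val = j.val then 1 else 0)

/-- The stabilizer of the surface code: the span of all star and plaquette checks. -/
def S (L : ℕ) : Submodule (ZMod 2) (PV L) :=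
  Submodule.span (ZMod 2)
    ((Set.range fun p : Fin (L - 1) × Fin L => starCheck L p.1 p.2) ∪
     (Set.range fun p : Fin L × Fin (L - 1) => plaqCheck L p.1 p.2))

/-- The logical `Z̄`: the Z-type vector supported on the column `{a(i,j₀) : 1 ≤ i ≤ L}`. -/
def Zbar (L : ℕ) (j₀ : Fin L) : PV L :=
  (0, fun q => match q with
    | Sum.inl (_, j') => if j' = j₀ then 1 else 0
    | Sum.inr _ => 0)

/-- The logical `X̄`: the X-type vector supported on the row `{a(i₀,j) : 1 ≤ j ≤ L}`. -/
def Xbar (L : ℕ) (i₀ : Fin L) : PV L :=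
  (fun q => match q with
    | Sum.inl (i', _) => if i' = i₀ then 1 else 0
    | Sum.inr _ => 0,
   0)

theorem omg_comm {L : ℕ} (e e' : PV L) : omg e e' = omg e' e := add_comm _ _

theorem omg_add_right {L : ℕ} (e s t : PV L) : omg e (s + t) = omg e s + omg e t := by
  simp only [omg, Prod.fst_add, Prod.snd_add, Pi.add_apply, mul_add, add_mul,
    Finset.sum_add_distrib]
  ring

theorem omg_smul_right {L : ℕ} (c : ZMod 2) (e s : PV L) : omg e (c • s) = c * omg e s := by
  simp only [omg, Prod.smul_fst, Prod.smul_snd, Pi.smul_apply, smul_eq_mul, mul_add,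
    Finset.mul_sum]
  congr 1 <;> exact Finset.sum_congr rfl fun _ _ => by ring

/-- A vector commuting with every check commutes with the whole stabilizer. -/
theorem omg_eq_zero_of_checks {L : ℕ} {e : PV L}
    (hstar : ∀ i j, omg e (starCheck L i j) = 0) (hplaq : ∀ i j, omg e (plaqCheck L i j) = 0) :
    ∀ s ∈ S L, omg e s = 0 := by
  intro s hs
  induction hs using Submodule.span_induction with
  | mem x hx =>
    rcases hx with ⟨p, rfl⟩ | ⟨p, rfl⟩
    · exact hstar _ _
    · exact hplaq _ _
  | zero => simp [omg]
  | add x y _ _ hx hy => rw [omg_add_right, hx, hy, add_zero]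
  | smul c x _ hx => rw [omg_smul_right, hx, mul_zero]

/-- The vertical and the horizontal qubits contribute the same amount to the overlap of a star
with a plaquette. -/
theorem omg_star_plaq {L : ℕ} (i : Fin (L - 1)) (j : Fin L) (i' : Fin L) (j' : Fin (L - 1)) :
    omg (starCheck L i j) (plaqCheck L i' j') = 0 := by
  let c : ZMod 2 := if (i'.val = i.val ∨ i'.val = i.val + 1) ∧
    (j.val = j'.val ∨ j.val = j'.val + 1) then 1 else 0
  have hA : ∀ q : Fin L × Fin L, (starCheck L i j).1 (Sum.inl q) *
      (plaqCheck L i' j').2 (Sum.inl q) = if q = (i', j) then c else 0 := by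
    rintro ⟨x, y⟩
    simp only [starCheck, plaqCheck, c, Prod.mk.injEq, Fin.ext_iff, ← ite_and, ite_mul, one_mul,
      zero_mul]
    exact if_congr (by omega) rfl rfl
  have hB : ∀ q : Fin (L - 1) × Fin (L - 1), (starCheck L i j).1 (Sum.inr q) *
      (plaqCheck L i' j').2 (Sum.inr q) = if q = (i, j') then c else 0 := by
    rintro ⟨x, y⟩
    simp only [starCheck, plaqCheck, c, Prod.mk.injEq, Fin.ext_iff, ← ite_and, ite_mul, one_mul,
      zero_mul]
    exact if_congr (by omega) rfl rfl
  have h0 : ∑ q, (plaqCheck L i' j').1 q * (starCheck L i j).2 q = 0 := by simp [plaqCheck]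
  rw [omg, h0, add_zero, Fintype.sum_sum_type]
  simp only [hA, hB, Finset.sum_ite_eq', Finset.mem_univ, if_true]
  exact CharTwo.add_self_eq_zero c

theorem omg_star_star {L : ℕ} (i i' : Fin (L - 1)) (j j' : Fin L) :
    omg (starCheck L i j) (starCheck L i' j') = 0 := by
  simp [omg, starCheck]

theorem omg_plaq_plaq {L : ℕ} (i i' : Fin L) (j j' : Fin (L - 1)) :
    omg (plaqCheck L i j) (plaqCheck L i' j') = 0 := by
  simp [omg, plaqCheck]

theorem S_isotropic {L : ℕ} : ∀ s ∈ S L, ∀ s' ∈ S L, omg s s' = 0 := by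
  intro s hs
  refine omg_eq_zero_of_checks (fun i j => ?_) fun i j => ?_
  · rw [omg_comm]
    exact omg_eq_zero_of_checks (fun _ _ => omg_star_star _ _ _ _)
      (fun _ _ => omg_star_plaq _ _ _ _) s hs
  · rw [omg_comm]
    exact omg_eq_zero_of_checks (fun _ _ => (omg_comm _ _).trans (omg_star_plaq _ _ _ _))
      (fun _ _ => omg_plaq_plaq _ _ _ _) s hs

theorem sum_adjacent_pair {L : ℕ} (k : Fin (L - 1)) :
    (∑ x : Fin L, if x.val = k.val ∨ x.val = k.val + 1 then (1 : ZMod 2) else 0) = 0 := by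
  have h : ∀ x : Fin L, (if x.val = k.val ∨ x.val = k.val + 1 then (1 : ZMod 2) else 0) =
      (if x = ⟨k.val, by omega⟩ then 1 else 0) + if x = ⟨k.val + 1, by omega⟩ then 1 else 0 := by
    intro x
    simp only [Fin.ext_iff]
    split_ifs <;> first | omega | simp
  simp only [h, Finset.sum_add_distrib, Finset.sum_ite_eq', Finset.mem_univ, if_true]
  exact CharTwo.add_self_eq_zero 1

theorem Zbar_mem_perp {L : ℕ} (j₀ : Fin L) : ∀ s ∈ S L, omg (Zbar L j₀) s = 0 := by
  refine omg_eq_zero_of_checks (fun i j => ?_) fun i j => by simp [omg, Zbar, plaqCheck]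
  by_cases hj : j₀ = j
  · subst hj
    simpa [omg, Zbar, starCheck, Fintype.sum_prod_type, ite_and] using sum_adjacent_pair i
  · simp [omg, Zbar, starCheck, Fintype.sum_prod_type, ite_and, hj]

theorem Xbar_mem_perp {L : ℕ} (i₀ : Fin L) : ∀ s ∈ S L, omg (Xbar L i₀) s = 0 := by
  refine omg_eq_zero_of_checks (fun i j => by simp [omg, Xbar, starCheck]) fun i j => ?_
  by_cases hi : i₀ = i
  · subst hi
    simpa [omg, Xbar, plaqCheck, Fintype.sum_prod_type_right, ite_and] using sum_adjacent_pair j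
  · simp [omg, Xbar, plaqCheck, Fintype.sum_prod_type_right, ite_and, Ne.symm hi]

theorem omg_Zbar_Xbar {L : ℕ} (j₀ i₀ : Fin L) : omg (Zbar L j₀) (Xbar L i₀) = 1 := by
  simp [omg, Zbar, Xbar, Fintype.sum_prod_type]

theorem wt_Zbar {L : ℕ} (j₀ : Fin L) : wt (Zbar L j₀) = L := by
  have h : (Finset.univ.filter fun q => (Zbar L j₀).1 q ≠ 0 ∨ (Zbar L j₀).2 q ≠ 0) =
      Finset.univ.image fun i : Fin L => (Sum.inl (i, j₀) : Qbit L) := by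
    ext q
    rcases q with ⟨x, y⟩ | q <;> simp [Zbar, eq_comm]
  rw [wt, h, Finset.card_image_of_injective _ fun a b hab => by simpa using hab]
  simp

theorem wt_Xbar {L : ℕ} (i₀ : Fin L) : wt (Xbar L i₀) = L := by
  have h : (Finset.univ.filter fun q => (Xbar L i₀).1 q ≠ 0 ∨ (Xbar L i₀).2 q ≠ 0) =
      Finset.univ.image fun j : Fin L => (Sum.inl (i₀, j) : Qbit L) := by
    ext q
    rcases q with ⟨x, y⟩ | q <;> simp [Xbar, eq_comm]
  rw [wt, h, Finset.card_image_of_injective _ fun a b hab => by simpa using hab]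
  simp

/-- Surface code algebra: (a) every star commutes with every plaquette, so the stabilizer
`S` is ω-isotropic; (b) `Z̄, X̄ ∈ S^⊥`; (c) `ω(Z̄, X̄) = 1`; (d) `Z̄ ∉ S`, `X̄ ∉ S`, and
both have weight `L`. -/
theorem surface_code_logical_qubit (L : ℕ) (hL : 2 ≤ L) (j₀ i₀ : Fin L) :
    (∀ (i : Fin (L - 1)) (j : Fin L) (i' : Fin L) (j' : Fin (L - 1)),
        omg (starCheck L i j) (plaqCheck L i' j') = 0) ∧
    (∀ s ∈ S L, ∀ s' ∈ S L, omg s s' = 0) ∧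
    (∀ s ∈ S L, omg (Zbar L j₀) s = 0) ∧
    (∀ s ∈ S L, omg (Xbar L i₀) s = 0) ∧
    omg (Zbar L j₀) (Xbar L i₀) = 1 ∧
    Zbar L j₀ ∉ S L ∧
    Xbar L i₀ ∉ S L ∧
    wt (Zbar L j₀) = L ∧
    wt (Xbar L i₀) = L := by
  refine ⟨omg_star_plaq, S_isotropic, Zbar_mem_perp j₀, Xbar_mem_perp i₀, omg_Zbar_Xbar j₀ i₀,
    fun h => ?_, fun h => ?_, wt_Zbar j₀, wt_Xbar i₀⟩
  · exact one_ne_zero ((omg_Zbar_Xbar j₀ i₀).symm.trans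
      ((omg_comm _ _).trans (Xbar_mem_perp i₀ _ h)))
  · exact one_ne_zero ((omg_Zbar_Xbar j₀ i₀).symm.trans (Zbar_mem_perp j₀ _ h))

end QEC17
end

section
/- (Surface code parameters [[L²+(L−1)², 1, L]].) Fix L ≥ 2 and let S ⊆ ((ZMod 2)^Q)² be the span of the star and plaquette check vectors of the L × L surface code as defined (qubits Q = A ∪ B with |Q| = n = L² + (L−1)², stars s(i,j) for 1 ≤ i ≤ L−1, 1 ≤ j ≤ L with u-support {a(i,j), a(i+1,j)} ∪ {b(i,j−1) : j ≥ 2} ∪ {b(i,j) : j ≤ L−1}, plaquettes p(i,j) for 1 ≤ i ≤ L, 1 ≤ j ≤ L−1 with v-support {a(i,j), a(i,j+1)} ∪ {b(i−1,j) : i ≥ 2} ∪ {b(i,j) : i ≤ L−1}). Then: (a) dim S = n − 1, i.e., the 2L(L−1) check vectors are linearly independent, so the code encodes exactly one qubit; (b) the minimum weight of an element of S^⊥ \ S equals L, i.e., the surface code has distance L. -/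
namespace QEC18

/-- The qubits of the `L × L` surface code: `A = Fin L × Fin L` (vertical edges, 0-based
indexing of the `1 ≤ i,j ≤ L` of the statement) and `B = Fin (L-1) × Fin (L-1)`
(horizontal edges). -/
abbrev Qbit (L : ℕ) := (Fin L × Fin L) ⊕ (Fin (L - 1) × Fin (L - 1))

/-- Pauli operators up to phase on the surface-code qubits: pairs `(u,v)` with `u` the
X-part and `v` the Z-part. -/
abbrev PV (L : ℕ) := (Qbit L → ZMod 2) × (Qbit L → ZMod 2)

/-- The weight of `e = (u,v)`: the number of qubits `q` with `(u_q, v_q) ≠ (0,0)`. -/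
def wt {L : ℕ} (e : PV L) : ℕ :=
  (Finset.univ.filter fun q => e.1 q ≠ 0 ∨ e.2 q ≠ 0).card

/-- The symplectic form `ω(e,e′) = u·v′ + u′·v ∈ ZMod 2`. -/
def omg {L : ℕ} (e e' : PV L) : ZMod 2 :=
  (∑ q, e.1 q * e'.2 q) + ∑ q, e'.1 q * e.2 q

/-- The star (X-type) check `s(i,j)` (`1 ≤ i ≤ L−1`, `1 ≤ j ≤ L`, here 0-based), with
u-support `{a(i,j), a(i+1,j)} ∪ {b(i,j−1) : j ≥ 2} ∪ {b(i,j) : j ≤ L−1}`. -/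
def starCheck (L : ℕ) (i : Fin (L - 1)) (j : Fin L) : PV L :=
  (fun q => match q with
    | Sum.inl (i', j') =>
        if (i'.val = i.val ∨ i'.val = i.val + 1) ∧ j' = j then 1 else 0
    | Sum.inr (i', j') =>
        if i'.val = i.val ∧ (j'.val + 1 = j.val ∨ j'.val = j.val) then 1 else 0,
   0)

/-- The plaquette (Z-type) check `p(i,j)` (`1 ≤ i ≤ L`, `1 ≤ j ≤ L−1`, here 0-based), with
v-support `{a(i,j), a(i,j+1)} ∪ {b(i−1,j) : i ≥ 2} ∪ {b(i,j) : i ≤ L−1}`. -/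
def plaqCheck (L : ℕ) (i : Fin L) (j : Fin (L - 1)) : PV L :=
  (0,
   fun q => match q with
    | Sum.inl (i', j') =>
        if i' = i ∧ (j'.val = j.val ∨ j'.val = j.val + 1) then 1 else 0
    | Sum.inr (i', j') =>
        if (i'.val + 1 = i.val ∨ i'.val = i.val) ∧ j'.val = j.val then 1 else 0)

/-- The stabilizer of the surface code: the span of all star and plaquette checks. -/
def S (L : ℕ) : Submodule (ZMod 2) (PV L) :=
  Submodule.span (ZMod 2)
    ((Set.range fun p : Fin (L - 1) × Fin L => starCheck L p.1 p.2) ∪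
     (Set.range fun p : Fin L × Fin (L - 1) => plaqCheck L p.1 p.2))

/-- Reflection of the lattice in its diagonal, which exchanges stars and plaquettes. -/
def transpose (L : ℕ) : Qbit L ≃ Qbit L :=
  (Equiv.prodComm _ _).sumCongr (Equiv.prodComm _ _)

@[simp] lemma transpose_inl {L : ℕ} (i j : Fin L) :
    transpose L (Sum.inl (i, j)) = Sum.inl (j, i) := rfl

@[simp] lemma transpose_inr {L : ℕ} (i j : Fin (L - 1)) :
    transpose L (Sum.inr (i, j)) = Sum.inr (j, i) := rfl

@[simp] lemma transpose_transpose {L : ℕ} (q : Qbit L) :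
    transpose L (transpose L q) = q := by
  rcases q with ⟨i, j⟩ | ⟨i, j⟩ <;> rfl

/-- The X-part of a star check, indexed by natural numbers. -/
def starVec (L i j : ℕ) : Qbit L → ZMod 2
  | Sum.inl (i', j') =>
      ((if i'.val = i then 1 else 0) + (if i'.val = i + 1 then 1 else 0)) *
        (if j'.val = j then 1 else 0)
  | Sum.inr (i', j') =>
      (if i'.val = i then 1 else 0) *
        ((if j'.val + 1 = j then 1 else 0) + (if j'.val = j then 1 else 0))

lemma starCheck_eq (L : ℕ) (i : Fin (L - 1)) (j : Fin L) :
    starCheck L i j = (starVec L i j, 0) := by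
  refine Prod.ext (funext fun q => ?_) rfl
  rcases q with ⟨i', j'⟩ | ⟨i', j'⟩ <;> simp only [starCheck, starVec, Fin.ext_iff] <;>
    split_ifs <;> first | omega | simp

lemma plaqCheck_eq (L : ℕ) (i : Fin L) (j : Fin (L - 1)) :
    plaqCheck L i j = (0, starVec L j i ∘ transpose L) := by
  refine Prod.ext rfl (funext fun q => ?_)
  rcases q with ⟨i', j'⟩ | ⟨i', j'⟩ <;>
    simp only [plaqCheck, starVec, Fin.ext_iff, Function.comp, transpose_inl, transpose_inr] <;>
    split_ifs <;> first | omega | simp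

/-- The values on the vertical edges, extended by zero to `ℕ × ℕ`. -/
def vert {L : ℕ} (w : Qbit L → ZMod 2) (i j : ℕ) : ZMod 2 :=
  if h : i < L ∧ j < L then w (Sum.inl (⟨i, h.1⟩, ⟨j, h.2⟩)) else 0

/-- The values on the horizontal edges, extended by zero to `ℕ × ℕ`. -/
def horiz {L : ℕ} (w : Qbit L → ZMod 2) (i j : ℕ) : ZMod 2 :=
  if h : i < L - 1 ∧ j < L - 1 then w (Sum.inr (⟨i, h.1⟩, ⟨j, h.2⟩)) else 0

@[simp] lemma vert_val {L : ℕ} (w : Qbit L → ZMod 2) (i j : Fin L) :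
    vert w i j = w (Sum.inl (i, j)) := by simp [vert]

@[simp] lemma horiz_val {L : ℕ} (w : Qbit L → ZMod 2) (i j : Fin (L - 1)) :
    horiz w i j = w (Sum.inr (i, j)) := by simp [horiz]

lemma vert_transpose {L : ℕ} (w : Qbit L → ZMod 2) (i j : ℕ) :
    vert (w ∘ transpose L) i j = vert w j i := by
  simp only [vert, and_comm (a := i < L)]; rfl

lemma horiz_transpose {L : ℕ} (w : Qbit L → ZMod 2) (i j : ℕ) :
    horiz (w ∘ transpose L) i j = horiz w j i := by
  simp only [horiz, and_comm (a := i < L - 1)]; rfl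

lemma sum_mul_ite_val {n : ℕ} (f : ℕ → ZMod 2) (i : ℕ) :
    ∑ k : Fin n, f k * (if k.val = i then 1 else 0) = if i < n then f i else 0 := by
  rw [Fin.sum_univ_eq_sum_range fun k => f k * (if k = i then 1 else 0)]
  simp

lemma sum_sum_mul_ite_val {m n : ℕ} (f : ℕ → ℕ → ZMod 2) (i j : ℕ) :
    ∑ k : Fin m, ∑ l : Fin n,
      f k l * ((if k.val = i then 1 else 0) * (if l.val = j then 1 else 0)) =
      if i < m ∧ j < n then f i j else 0 := by
  simp_rw [mul_comm (ite (Fin.val _ = i) _ _), ← mul_assoc, ← Finset.sum_mul,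
    sum_mul_ite_val (f _), sum_mul_ite_val fun k => if j < n then f k j else 0, ite_and]

lemma sum_mul_starVec {L : ℕ} (w : Qbit L → ZMod 2) (i j : ℕ) :
    ∑ q, w q * starVec L i j q = vert w i j + vert w (i + 1) j +
      ((if j = 0 then 0 else horiz w i (j - 1)) + horiz w i j) := by
  have hv (i j : ℕ) : (if i < L ∧ j < L then vert w i j else 0) = vert w i j := by
    unfold vert; split_ifs <;> rfl
  have hh (i j : ℕ) : (if i < L - 1 ∧ j < L - 1 then horiz w i j else 0) = horiz w i j := by
    unfold horiz; split_ifs <;> rfl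
  simp only [Fintype.sum_sum_type, Fintype.sum_prod_type, starVec, ← vert_val, ← horiz_val,
    add_mul, mul_add, Finset.sum_add_distrib, sum_sum_mul_ite_val, hv, hh]
  congr 2
  rcases j with _ | j
  · simp
  · simp only [Nat.add_right_cancel_iff, sum_sum_mul_ite_val, hh, Nat.add_one_ne_zero, if_false,
      Nat.add_sub_cancel]

lemma sum_mul_starVec_inl {L : ℕ} (X : ℕ → ℕ → ZMod 2) (i j : Fin L) :
    ∑ p : Fin (L - 1) × Fin L, X p.1 p.2 * starVec L p.1 p.2 (Sum.inl (i, j)) =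
      (if i.val < L - 1 then X i j else 0) + if i.val = 0 then 0 else X (i - 1) j := by
  simp only [Fintype.sum_prod_type, starVec, add_mul, mul_add, Finset.sum_add_distrib,
    eq_comm (a := i.val), eq_comm (a := j.val), sum_sum_mul_ite_val, j.isLt, and_true]
  congr 1
  obtain ⟨_ | i, hi⟩ := i
  · simp
  · have : i < L - 1 := by omega
    simp only [Nat.add_right_cancel_iff, sum_sum_mul_ite_val, this, j.isLt, and_self, if_true,
      (Nat.add_one_ne_zero i).symm, if_false, Nat.add_sub_cancel]

lemma sum_mul_starVec_inr {L : ℕ} (X : ℕ → ℕ → ZMod 2) (i j : Fin (L - 1)) :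
    ∑ p : Fin (L - 1) × Fin L, X p.1 p.2 * starVec L p.1 p.2 (Sum.inr (i, j)) =
      X i (j + 1) + X i j := by
  have h₁ : j.val + 1 < L := by omega
  have h₂ : j.val < L := by omega
  simp only [Fintype.sum_prod_type, starVec, mul_add, Finset.sum_add_distrib,
    eq_comm (a := i.val), eq_comm (a := j.val), eq_comm (a := j.val + 1),
    sum_sum_mul_ite_val, i.isLt, h₁, h₂, and_true, if_true]

lemma eq_zero_of_sum_mul_starVec {L : ℕ} {x : Fin (L - 1) × Fin L → ZMod 2}
    (h : ∀ q, ∑ p, x p * starVec L p.1 p.2 q = 0) : x = 0 := by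
  let X (i j : ℕ) : ZMod 2 := if h : i < L - 1 ∧ j < L then x (⟨i, h.1⟩, ⟨j, h.2⟩) else 0
  have hX (p : Fin (L - 1) × Fin L) : X p.1 p.2 = x p := by simp [X]
  have key (j : ℕ) (hj : j < L) (i : ℕ) : i < L - 1 → X i j = 0 := by
    induction i with
    | zero =>
      intro hi
      have := sum_mul_starVec_inl X ⟨0, by omega⟩ ⟨j, hj⟩
      simpa [hX, h, hi] using this.symm
    | succ i ih =>
      intro hi
      have := sum_mul_starVec_inl X ⟨i + 1, by omega⟩ ⟨j, hj⟩
      simpa [hX, h, hi, ih (by omega)] using this.symm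
  funext p
  rw [← hX, key _ p.2.isLt _ p.1.isLt, Pi.zero_apply]

/-- `w`, regarded as an X-type vector, commutes with all plaquettes. -/
def IsCycle {L : ℕ} (w : Qbit L → ZMod 2) : Prop :=
  ∀ i < L, ∀ j < L - 1, ∑ q, w q * starVec L j i (transpose L q) = 0

lemma sum_mul_comp_transpose {L : ℕ} (w f : Qbit L → ZMod 2) :
    ∑ q, w q * f (transpose L q) = ∑ q, (w ∘ transpose L) q * f q := by
  rw [← Equiv.sum_comp (transpose L)]
  simp

lemma isCycle_comp_transpose {L : ℕ} {w : Qbit L → ZMod 2} :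
    IsCycle (w ∘ transpose L) ↔ ∀ i < L, ∀ j < L - 1, ∑ q, w q * starVec L j i q = 0 := by
  have : (w ∘ transpose L) ∘ transpose L = w := by ext; simp
  simp only [IsCycle, sum_mul_comp_transpose (w ∘ transpose L), this]

lemma IsCycle.sum_vert {L : ℕ} {w : Qbit L → ZMod 2} (hw : IsCycle w) {j : ℕ} (hj : j < L - 1)
    (n : ℕ) (hn : n < L) :
    ∑ k ∈ Finset.range (n + 1), vert w k (j + 1) + ∑ k ∈ Finset.range (n + 1), vert w k j =
      horiz w n j := by
  have h (i : ℕ) (hi : i < L) := hw i hi j hj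
  simp only [sum_mul_comp_transpose, sum_mul_starVec, vert_transpose, horiz_transpose] at h
  induction n with
  | zero =>
    have := h 0 hn
    simp at this ⊢
    grind
  | succ n ih =>
    have h₁ := h (n + 1) hn
    have h₂ := ih (by omega)
    rw [Finset.sum_range_succ, Finset.sum_range_succ _ (n + 1)]
    simp at h₁
    grind

lemma IsCycle.sum_vert_eq {L : ℕ} {w : Qbit L → ZMod 2} (hw : IsCycle w) (j : ℕ) (hj : j < L) :
    ∑ k ∈ Finset.range L, vert w k j = ∑ k ∈ Finset.range L, vert w k 0 := by
  induction j with
  | zero => rfl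
  | succ j ih =>
    rw [← ih (by omega)]
    have := hw.sum_vert (j := j) (by omega) (L - 1) (by omega)
    rw [Nat.sub_add_cancel (by omega), horiz, dif_neg (by omega)] at this
    exact CharTwo.add_eq_zero.mp this

lemma IsCycle.exists_sum_starVec {L : ℕ} {w : Qbit L → ZMod 2} (hw : IsCycle w)
    (h : ∑ k ∈ Finset.range L, vert w k 0 = 0) :
    ∃ x : Fin (L - 1) × Fin L → ZMod 2, ∀ q, ∑ p, x p * starVec L p.1 p.2 q = w q := by
  let X (i j : ℕ) : ZMod 2 := ∑ k ∈ Finset.range (i + 1), vert w k j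
  refine ⟨fun p => X p.1 p.2, fun q => ?_⟩
  rcases q with ⟨i, j⟩ | ⟨i, j⟩
  · rw [sum_mul_starVec_inl]
    have hX : (if i.val < L - 1 then X i j else 0) = X i j := by
      split_ifs with hi
      · rfl
      · have : i.val + 1 = L := by omega
        simp only [X, this, hw.sum_vert_eq _ j.isLt, h]
    rw [hX, ← vert_val w]
    obtain ⟨_ | i, hi⟩ := i
    · simp [X]
    · simp only [X, Finset.sum_range_succ _ (i + 1), Nat.add_sub_cancel, Nat.add_one_ne_zero,
        if_false]
      grind
  · rw [sum_mul_starVec_inr, hw.sum_vert j.isLt _ (by omega), horiz_val]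

lemma IsCycle.le_card {L : ℕ} {w : Qbit L → ZMod 2} (hw : IsCycle w)
    (h : ∑ k ∈ Finset.range L, vert w k 0 ≠ 0) (s : Finset (Qbit L))
    (hs : ∀ q, w q ≠ 0 → q ∈ s) : L ≤ s.card := by
  have hex (j : Fin L) : ∃ i : Fin L, w (Sum.inl (i, j)) ≠ 0 := by
    rw [← hw.sum_vert_eq j j.isLt] at h
    obtain ⟨i, hi, hne⟩ := Finset.exists_ne_zero_of_sum_ne_zero h
    exact ⟨⟨i, Finset.mem_range.mp hi⟩, by rwa [← vert_val w]⟩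
  choose g hg using hex
  have := Finset.card_le_card_of_injOn (s := (Finset.univ : Finset (Fin L))) (t := s)
    (fun j => Sum.inl (g j, j)) (fun j _ => hs _ (hg j)) (fun j _ k _ hjk => by simp_all)
  simpa using this

lemma omg_add {L : ℕ} (e s t : PV L) : omg e (s + t) = omg e s + omg e t := by
  simp only [omg, Prod.fst_add, Prod.snd_add, Pi.add_apply, mul_add, add_mul,
    Finset.sum_add_distrib]
  ring

lemma omg_smul {L : ℕ} (e : PV L) (c : ZMod 2) (s : PV L) : omg e (c • s) = c * omg e s := by
  simp only [omg, Prod.smul_fst, Prod.smul_snd, Pi.smul_apply, smul_eq_mul, mul_add,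
    Finset.mul_sum]
  congr 1 <;> exact Finset.sum_congr rfl fun _ _ => by ring

lemma omg_starCheck {L : ℕ} (e : PV L) (i : Fin (L - 1)) (j : Fin L) :
    omg e (starCheck L i j) = ∑ q, e.2 q * starVec L i j q := by
  simp [omg, starCheck_eq, mul_comm]

lemma omg_plaqCheck {L : ℕ} (e : PV L) (i : Fin L) (j : Fin (L - 1)) :
    omg e (plaqCheck L i j) = ∑ q, e.1 q * starVec L j i (transpose L q) := by
  simp [omg, plaqCheck_eq]

lemma starCheck_mem (L : ℕ) (i : Fin (L - 1)) (j : Fin L) : starCheck L i j ∈ S L :=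
  Submodule.subset_span (Or.inl ⟨(i, j), rfl⟩)

lemma plaqCheck_mem (L : ℕ) (i : Fin L) (j : Fin (L - 1)) : plaqCheck L i j ∈ S L :=
  Submodule.subset_span (Or.inr ⟨(i, j), rfl⟩)

/-- The centralizer of the stabilizer consists of pairs of cycles on the lattice and its dual. -/
lemma forall_omg_eq_zero_iff {L : ℕ} (e : PV L) :
    (∀ s ∈ S L, omg e s = 0) ↔ IsCycle e.1 ∧ IsCycle (e.2 ∘ transpose L) := by
  rw [isCycle_comp_transpose]
  constructor
  · intro h
    refine ⟨fun i hi j hj => ?_, fun i hi j hj => ?_⟩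
    · rw [← h _ (plaqCheck_mem L ⟨i, hi⟩ ⟨j, hj⟩), omg_plaqCheck]
    · rw [← h _ (starCheck_mem L ⟨j, hj⟩ ⟨i, hi⟩), omg_starCheck]
  · rintro ⟨h₁, h₂⟩ s hs
    induction hs using Submodule.span_induction with
    | mem s hs =>
      rcases hs with ⟨⟨i, j⟩, rfl⟩ | ⟨⟨i, j⟩, rfl⟩
      · exact (omg_starCheck e i j).trans (h₂ _ j.isLt _ i.isLt)
      · exact (omg_plaqCheck e i j).trans (h₁ _ i.isLt _ j.isLt)
    | zero => simp [omg]
    | add s t _ _ hs ht => rw [omg_add, hs, ht, add_zero]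
    | smul c s _ hs => rw [omg_smul, hs, mul_zero]

lemma mem_S {L : ℕ} {e : PV L} (h₁ : IsCycle e.1) (h₂ : IsCycle (e.2 ∘ transpose L))
    (hs₁ : ∑ k ∈ Finset.range L, vert e.1 k 0 = 0)
    (hs₂ : ∑ k ∈ Finset.range L, vert (e.2 ∘ transpose L) k 0 = 0) : e ∈ S L := by
  obtain ⟨x, hx⟩ := h₁.exists_sum_starVec hs₁
  obtain ⟨y, hy⟩ := h₂.exists_sum_starVec hs₂
  have he : e = ∑ p, x p • starCheck L p.1 p.2 + ∑ p, y p • plaqCheck L p.2 p.1 := by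
    refine Prod.ext (funext fun q => ?_) (funext fun q => ?_)
    · simp [starCheck_eq, plaqCheck_eq, Prod.fst_sum, hx]
    · simp [starCheck_eq, plaqCheck_eq, Prod.snd_sum, hy]
  rw [he]
  exact add_mem (sum_mem fun p _ => Submodule.smul_mem _ _ (starCheck_mem L _ _))
    (sum_mem fun p _ => Submodule.smul_mem _ _ (plaqCheck_mem L _ _))

lemma linearIndependent_checks (L : ℕ) :
    LinearIndependent (ZMod 2)
      (Sum.elim (fun p : Fin (L - 1) × Fin L => starCheck L p.1 p.2)
        (fun p : Fin L × Fin (L - 1) => plaqCheck L p.1 p.2)) := by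
  rw [Fintype.linearIndependent_iff]
  intro g hg
  rw [Fintype.sum_sum_type] at hg
  simp only [Sum.elim_inl, Sum.elim_inr, starCheck_eq, plaqCheck_eq] at hg
  have h₁ : (fun p => g (Sum.inl p)) = 0 := by
    refine eq_zero_of_sum_mul_starVec fun q => ?_
    simpa [Prod.fst_sum] using congrFun (congrArg Prod.fst hg) q
  have h₂ : (fun p : Fin (L - 1) × Fin L => g (Sum.inr p.swap)) = 0 := by
    refine eq_zero_of_sum_mul_starVec fun q => ?_
    have := congrFun (congrArg Prod.snd hg) (transpose L q)
    rw [← Equiv.sum_comp (Equiv.prodComm _ _)]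
    simpa [Prod.snd_sum] using this
  rintro (p | p)
  · exact congrFun h₁ p
  · exact congrFun h₂ p.swap

lemma finrank_S (L : ℕ) (hL : 2 ≤ L) :
    Module.finrank (ZMod 2) (S L) = L ^ 2 + (L - 1) ^ 2 - 1 := by
  have h := finrank_span_eq_card (linearIndependent_checks L)
  rw [Set.Sum.elim_range] at h
  rw [S, h]
  obtain ⟨m, rfl⟩ := Nat.exists_eq_add_of_le' hL
  simp only [Fintype.card_sum, Fintype.card_prod, Fintype.card_fin,
    show m + 2 - 1 = m + 1 from rfl]
  refine Nat.eq_sub_of_add_eq ?_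
  ring

/-- The indicator of the first column of vertical edges. -/
def column (L : ℕ) : Qbit L → ZMod 2
  | Sum.inl (_, j) => if j.val = 0 then 1 else 0
  | Sum.inr _ => 0

lemma isCycle_column_comp_transpose (L : ℕ) : IsCycle (column L ∘ transpose L) := by
  rw [isCycle_comp_transpose]
  intro j hj i hi
  rw [sum_mul_starVec]
  have h₁ : vert (column L) i j = if j = 0 then 1 else 0 := by
    rw [vert, dif_pos (by omega)]; rfl
  have h₂ : vert (column L) (i + 1) j = if j = 0 then 1 else 0 := by
    rw [vert, dif_pos (by omega)]; rfl
  have h₃ (k l : ℕ) : horiz (column L) k l = 0 := by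
    unfold horiz; split_ifs <;> rfl
  simp [h₁, h₂, h₃, CharTwo.add_self_eq_zero]

lemma isCycle_zero (L : ℕ) : IsCycle (0 : Qbit L → ZMod 2) := fun _ _ _ _ => by simp

lemma wt_column {L : ℕ} (hL : 0 < L) :
    wt ((column L ∘ transpose L, 0) : PV L) = L := by
  have : (Finset.univ.filter fun q => (column L ∘ transpose L) q ≠ 0 ∨
      (0 : Qbit L → ZMod 2) q ≠ 0) =
      (Finset.univ : Finset (Fin L)).image fun j => Sum.inl (⟨0, hL⟩, j) := by
    ext q
    rcases q with ⟨i, j⟩ | ⟨i, j⟩ <;> simp [column, Fin.ext_iff, eq_comm]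
  rw [wt, this, Finset.card_image_of_injective _ fun j k hjk => by simpa using hjk]
  simp

lemma column_notMem_S {L : ℕ} (hL : 0 < L) :
    ((column L ∘ transpose L, 0) : PV L) ∉ S L := by
  intro h
  have h₀ := (forall_omg_eq_zero_iff (0, column L)).mpr
    ⟨isCycle_zero L, isCycle_column_comp_transpose L⟩ _ h
  have h₁ : omg ((0, column L) : PV L) (column L ∘ transpose L, 0) = 1 := by
    have hc (i j : Fin L) : column L (Sum.inl (i, j)) = if j.val = 0 then 1 else 0 := rfl
    have hr (q : Fin (L - 1) × Fin (L - 1)) : column L (Sum.inr q) = 0 := rfl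
    simpa [omg, Fintype.sum_prod_type, hc, hr, hL] using
      sum_sum_mul_ite_val (m := L) (n := L) (fun _ _ => 1) 0 0
  exact one_ne_zero (h₁.symm.trans h₀)

/-- Surface code parameters `[[L² + (L−1)², 1, L]]`: (a) the `2L(L−1)` star and plaquette
check vectors are linearly independent and the stabilizer has dimension `n − 1` with
`n = L² + (L−1)²`, so the code encodes exactly one qubit; (b) the minimum weight of an
element of `S^⊥ \ S` equals `L`, i.e. the surface code has distance `L`. -/
theorem surface_code_parameters (L : ℕ) (hL : 2 ≤ L) :
    (LinearIndependent (ZMod 2)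
        (Sum.elim (fun p : Fin (L - 1) × Fin L => starCheck L p.1 p.2)
          (fun p : Fin L × Fin (L - 1) => plaqCheck L p.1 p.2)) ∧
      Module.finrank (ZMod 2) (S L) = L ^ 2 + (L - 1) ^ 2 - 1) ∧
    IsLeast {w : ℕ | ∃ e : PV L, (∀ s ∈ S L, omg e s = 0) ∧ e ∉ S L ∧ wt e = w} L := by
  refine ⟨⟨linearIndependent_checks L, finrank_S L hL⟩, ?_, ?_⟩
  · exact ⟨(column L ∘ transpose L, 0), (forall_omg_eq_zero_iff _).mpr
      ⟨isCycle_column_comp_transpose L, isCycle_zero L⟩, column_notMem_S (by omega),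
      wt_column (by omega)⟩
  · rintro _ ⟨e, he, hmem, rfl⟩
    obtain ⟨h₁, h₂⟩ := (forall_omg_eq_zero_iff e).mp he
    by_cases hs₁ : ∑ k ∈ Finset.range L, vert e.1 k 0 = 0
    · have hs₂ := fun hs₂ => hmem (mem_S h₁ h₂ hs₁ hs₂)
      rw [wt, ← Finset.card_map (transpose L).toEmbedding]
      refine h₂.le_card hs₂ _ fun q hq => ?_
      exact Finset.mem_map.mpr ⟨transpose L q, by simpa using Or.inr hq, by simp⟩
    · exact h₁.le_card hs₁ _ fun q hq => by simp [hq]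

end QEC18
end

section
/- (Bacon–Shor subsystem code has distance n.) Fix n ≥ 2 and index n² qubits by pairs (i,j) ∈ {1,…,n}² (row i, column j). Let g ⊆ ((ZMod 2)^{n²})² be the F₂-span of the gauge generators: the X-type vertical links with u-support {(i,j),(i+1,j)} for 1 ≤ i ≤ n−1, 1 ≤ j ≤ n (v = 0), and the Z-type horizontal links with v-support {(i,j),(i,j+1)} for 1 ≤ i ≤ n, 1 ≤ j ≤ n−1 (u = 0). Let S be the span of the 2(n−1) stabilizer checks: the Z-type double-column vectors Z_{||,j} with v-support {(i,j) : 1 ≤ i ≤ n} ∪ {(i,j+1) : 1 ≤ i ≤ n} for 1 ≤ j ≤ n−1, and the X-type double-row vectors X_{=,i} with u-support {(i,j) : 1 ≤ j ≤ n} ∪ {(i+1,j) : 1 ≤ j ≤ n} for 1 ≤ i ≤ n−1. Then: (a) S ⊆ g and every element of S is ω-orthogonal to every element of g (the stabilizer checks are products of gauge links and lie in the center of the gauge group); (b) the minimum weight of an element of S^⊥ \ g equals n; in particular the single-column Z-type vector with v-support {(i,j₀) : 1 ≤ i ≤ n} lies in S^⊥ \ g and has weight n. Hence the Bacon–Shor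 code is an [[n²,1,n]] subsystem code. -/
namespace QEC19

/-- Pauli operators up to phase on the `n × n` array of qubits (row `i`, column `j`):
pairs `(u,v)` with `u` the X-part and `v` the Z-part. -/
abbrev PV (n : ℕ) := (Fin n × Fin n → ZMod 2) × (Fin n × Fin n → ZMod 2)

/-- The weight of `e = (u,v)`: the number of qubits `q` with `(u_q, v_q) ≠ (0,0)`. -/
def wt {n : ℕ} (e : PV n) : ℕ :=
  (Finset.univ.filter fun q => e.1 q ≠ 0 ∨ e.2 q ≠ 0).card

/-- The symplectic form `ω(e,e′) = u·v′ + u′·v ∈ ZMod 2`. -/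
def omg {n : ℕ} (e e' : PV n) : ZMod 2 :=
  (∑ q, e.1 q * e'.2 q) + ∑ q, e'.1 q * e.2 q

/-- X-type vertical link gauge generator with u-support `{(i,j), (i+1,j)}` (0-based). -/
def xLink (n : ℕ) (i : Fin (n - 1)) (j : Fin n) : PV n :=
  (fun q => if q.2 = j ∧ (q.1.val = i.val ∨ q.1.val = i.val + 1) then 1 else 0, 0)

/-- Z-type horizontal link gauge generator with v-support `{(i,j), (i,j+1)}` (0-based). -/
def zLink (n : ℕ) (i : Fin n) (j : Fin (n - 1)) : PV n :=
  (0, fun q => if q.1 = i ∧ (q.2.val = j.val ∨ q.2.val = j.val + 1) then 1 else 0)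

/-- The gauge group (as an F₂-span): span of all vertical `XX` and horizontal `ZZ` links. -/
def gauge (n : ℕ) : Submodule (ZMod 2) (PV n) :=
  Submodule.span (ZMod 2)
    ((Set.range fun p : Fin (n - 1) × Fin n => xLink n p.1 p.2) ∪
     (Set.range fun p : Fin n × Fin (n - 1) => zLink n p.1 p.2))

/-- Z-type double-column stabilizer check `Z_{||,j}` with v-support on columns `j, j+1`. -/
def zCol (n : ℕ) (j : Fin (n - 1)) : PV n :=
  (0, fun q => if q.2.val = j.val ∨ q.2.val = j.val + 1 then 1 else 0)

/-- X-type double-row stabilizer check `X_{=,i}` with u-support on rows `i, i+1`. -/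
def xRow (n : ℕ) (i : Fin (n - 1)) : PV n :=
  (fun q => if q.1.val = i.val ∨ q.1.val = i.val + 1 then 1 else 0, 0)

/-- The stabilizer: the span of the `2(n−1)` double-column and double-row checks. -/
def stab (n : ℕ) : Submodule (ZMod 2) (PV n) :=
  Submodule.span (ZMod 2)
    ((Set.range fun j : Fin (n - 1) => zCol n j) ∪
     (Set.range fun i : Fin (n - 1) => xRow n i))

/-- The single-column Z-type logical vector with v-support `{(i,j₀) : 1 ≤ i ≤ n}`. -/
def singleCol (n : ℕ) (j₀ : Fin n) : PV n :=
  (0, fun q => if q.2 = j₀ then 1 else 0)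

/-- The parity of the X-part of `e` on column `j`. -/
def colParity {n : ℕ} (e : PV n) (j : Fin n) : ZMod 2 := ∑ i, e.1 (i, j)

/-- The parity of the Z-part of `e` on row `i`. -/
def rowParity {n : ℕ} (e : PV n) (i : Fin n) : ZMod 2 := ∑ j, e.2 (i, j)

/-- The lower endpoint of the link `a` of the path `0, …, n - 1`. -/
def linkFst {n : ℕ} (a : Fin (n - 1)) : Fin n := ⟨a.val, by omega⟩

/-- The upper endpoint of the link `a` of the path `0, …, n - 1`. -/
def linkSnd {n : ℕ} (a : Fin (n - 1)) : Fin n := ⟨a.val + 1, by omega⟩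

lemma linkFst_ne_linkSnd {n : ℕ} (a : Fin (n - 1)) : linkFst a ≠ linkSnd a := by
  simp [linkFst, linkSnd]

lemma val_eq_link_iff {n : ℕ} (a : Fin (n - 1)) (i : Fin n) :
    (i.val = a.val ∨ i.val = a.val + 1) ↔ (i = linkFst a ∨ i = linkSnd a) := by
  simp [linkFst, linkSnd, Fin.ext_iff]

lemma sum_ite_link {n : ℕ} {M : Type*} [AddCommMonoid M] (a : Fin (n - 1)) (f : Fin n → M) :
    (∑ i : Fin n, if i.val = a.val ∨ i.val = a.val + 1 then f i else 0) =
      f (linkFst a) + f (linkSnd a) := by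
  simp_rw [val_eq_link_iff]
  rw [← Finset.sum_filter, Finset.filter_or, Finset.filter_eq', Finset.filter_eq',
    Finset.sum_union (by simpa using linkFst_ne_linkSnd a)]
  simp

/-- An equivalence relation that relates the endpoints of every link relates everything. -/
lemma rel_of_links {n : ℕ} {r : Fin n → Fin n → Prop} (hr : Equivalence r)
    (h : ∀ a : Fin (n - 1), r (linkFst a) (linkSnd a)) (i k : Fin n) : r i k := by
  have h0 : ∀ (m : ℕ) (hm : m < n), r ⟨0, by omega⟩ ⟨m, hm⟩ := by
    intro m
    induction m with
    | zero => exact fun _ => hr.refl _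
    | succ m ih => exact fun hm => hr.trans (ih (by omega)) (h ⟨m, by omega⟩)
  exact hr.trans (hr.symm (h0 i i.2)) (h0 k k.2)

/-- An even combination of vectors lies in a submodule containing all the sums along links. -/
lemma sum_smul_mem_of_links {n : ℕ} {M : Type*} [AddCommGroup M] [Module (ZMod 2) M]
    (N : Submodule (ZMod 2) M) (p : Fin n → M)
    (hp : ∀ a : Fin (n - 1), p (linkFst a) + p (linkSnd a) ∈ N)
    (f : Fin n → ZMod 2) (hf : ∑ i, f i = 0) : ∑ i, f i • p i ∈ N := by
  rcases isEmpty_or_nonempty (Fin n) with _ | ⟨⟨k⟩⟩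
  · simp
  have hr : Equivalence fun i k => p i - p k ∈ N :=
    ⟨fun i => by simp, fun {i k} h => by simpa using N.neg_mem h,
      fun {i k l} h h' => by simpa using N.add_mem h h'⟩
  have hk := rel_of_links hr fun a => by
    have hneg : p (linkSnd a) = -p (linkSnd a) := by
      rw [eq_neg_iff_add_eq_zero, ← two_smul (ZMod 2), show (2 : ZMod 2) = 0 from rfl, zero_smul]
    have := hp a
    rwa [hneg, ← sub_eq_add_neg] at this
  have : ∑ i, f i • p i = ∑ i, f i • (p i - p k) := by
    simp [smul_sub, Finset.sum_sub_distrib, ← Finset.sum_smul, hf]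
  rw [this]
  exact N.sum_mem fun i _ => N.smul_mem _ (hk i k)

lemma omg_zCol {n : ℕ} (e : PV n) (j : Fin (n - 1)) :
    omg e (zCol n j) = colParity e (linkFst j) + colParity e (linkSnd j) := by
  simp only [omg, zCol, Pi.zero_apply, zero_mul, Finset.sum_const_zero, add_zero, mul_ite,
    mul_one, mul_zero, Fintype.sum_prod_type_right]
  rw [← sum_ite_link j (colParity e)]
  refine Finset.sum_congr rfl fun k _ => ?_
  split_ifs <;> simp [colParity]

lemma omg_xRow {n : ℕ} (e : PV n) (i : Fin (n - 1)) :
    omg e (xRow n i) = rowParity e (linkFst i) + rowParity e (linkSnd i) := by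
  simp only [omg, xRow, Pi.zero_apply, mul_zero, Finset.sum_const_zero, zero_add, ite_mul,
    one_mul, zero_mul, Fintype.sum_prod_type]
  rw [← sum_ite_link i (rowParity e)]
  refine Finset.sum_congr rfl fun k _ => ?_
  split_ifs <;> simp [rowParity]

lemma omg_comm {n : ℕ} (e e' : PV n) : omg e e' = omg e' e := add_comm _ _

/-- The symplectic form against a fixed vector, as a linear functional. -/
def omgLinear {n : ℕ} (e : PV n) : PV n →ₗ[ZMod 2] ZMod 2 where
  toFun := omg e
  map_add' x y := by
    simp only [omg, Prod.fst_add, Prod.snd_add, Pi.add_apply, mul_add, add_mul,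
      Finset.sum_add_distrib]
    ring
  map_smul' c x := by
    simp only [omg, Prod.smul_fst, Prod.smul_snd, Pi.smul_apply, smul_eq_mul, mul_add,
      Finset.mul_sum, RingHom.id_apply]
    congr 1 <;> exact Finset.sum_congr rfl fun _ _ => by ring

/-- A vector commutes with the stabilizer iff its column and row parities are constant. -/
lemma forall_mem_stab_omg_eq_zero_iff {n : ℕ} (e : PV n) :
    (∀ s ∈ stab n, omg e s = 0) ↔
      (∀ j k, colParity e j = colParity e k) ∧ ∀ i k, rowParity e i = rowParity e k := by
  constructor
  · intro h
    have eqv (f : Fin n → ZMod 2) : Equivalence fun i k => f i = f k :=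
      ⟨fun _ => rfl, Eq.symm, Eq.trans⟩
    refine ⟨rel_of_links (eqv _) fun a => ?_, rel_of_links (eqv _) fun a => ?_⟩
    · rw [← CharTwo.add_eq_zero, ← omg_zCol]
      exact h _ (Submodule.subset_span (Or.inl ⟨a, rfl⟩))
    · rw [← CharTwo.add_eq_zero, ← omg_xRow]
      exact h _ (Submodule.subset_span (Or.inr ⟨a, rfl⟩))
  · rintro ⟨hc, hr⟩
    change stab n ≤ LinearMap.ker (omgLinear e)
    rw [stab, Submodule.span_le]
    rintro _ (⟨j, rfl⟩ | ⟨i, rfl⟩)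
    · exact (omg_zCol e j).trans (CharTwo.add_eq_zero.2 (hc _ _))
    · exact (omg_xRow e i).trans (CharTwo.add_eq_zero.2 (hr _ _))

lemma single_add_single_apply {n : ℕ} (p q r : Fin n × Fin n) (hpq : p ≠ q) :
    (Pi.single p (1 : ZMod 2) + Pi.single q 1 : Fin n × Fin n → ZMod 2) r =
      if r = p ∨ r = q then 1 else 0 := by
  rw [Pi.add_apply, Pi.single_apply, Pi.single_apply]
  by_cases hp : r = p <;> by_cases hq : r = q <;> simp_all

lemma xLink_eq {n : ℕ} (a : Fin (n - 1)) (j : Fin n) :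
    xLink n a j = LinearMap.inl (ZMod 2) _ _ (Pi.single (linkFst a, j) 1) +
      LinearMap.inl (ZMod 2) _ _ (Pi.single (linkSnd a, j) 1) := by
  rw [← map_add]
  refine Prod.ext (funext fun r => ?_) rfl
  refine Eq.trans ?_ (single_add_single_apply _ _ r
    fun h => linkFst_ne_linkSnd a (congrArg Prod.fst h)).symm
  simp only [xLink, val_eq_link_iff, Prod.ext_iff]
  exact if_congr (by tauto) rfl rfl

lemma zLink_eq {n : ℕ} (i : Fin n) (a : Fin (n - 1)) :
    zLink n i a = LinearMap.inr (ZMod 2) _ _ (Pi.single (i, linkFst a) 1) +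
      LinearMap.inr (ZMod 2) _ _ (Pi.single (i, linkSnd a) 1) := by
  rw [← map_add]
  refine Prod.ext rfl (funext fun r => ?_)
  refine Eq.trans ?_ (single_add_single_apply _ _ r
    fun h => linkFst_ne_linkSnd a (congrArg Prod.snd h)).symm
  simp only [zLink, val_eq_link_iff, Prod.ext_iff]
  exact if_congr (by tauto) rfl rfl

lemma eq_sum_single {n : ℕ} (e : PV n) :
    e = (∑ j, ∑ i, e.1 (i, j) • LinearMap.inl (ZMod 2) _ _ (Pi.single (i, j) 1)) +
      ∑ i, ∑ j, e.2 (i, j) • LinearMap.inr (ZMod 2) _ _ (Pi.single (i, j) 1) := by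
  simp only [← map_smul, ← map_sum]
  rw [← Fintype.sum_prod_type_right fun q => e.1 q • Pi.single q (1 : ZMod 2),
    ← Fintype.sum_prod_type fun q => e.2 q • Pi.single q (1 : ZMod 2),
    ← pi_eq_sum_univ' e.1, ← pi_eq_sum_univ' e.2]
  simp

/-- The gauge span consists of the vectors with even X-part on every column and even Z-part on
every row. -/
lemma mem_gauge_iff {n : ℕ} (e : PV n) :
    e ∈ gauge n ↔ (∀ j, colParity e j = 0) ∧ ∀ i, rowParity e i = 0 := by
  constructor
  · intro he
    induction he using Submodule.span_induction with
    | mem x hx =>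
      rcases hx with ⟨⟨a, k⟩, rfl⟩ | ⟨⟨k, a⟩, rfl⟩
      · refine ⟨fun j => ?_, fun i => by simp [rowParity, xLink]⟩
        simp only [colParity, xLink]
        by_cases hj : j = k
        · simpa [hj] using (sum_ite_link a fun _ => (1 : ZMod 2)).trans (by decide)
        · simp [hj]
      · refine ⟨fun j => by simp [colParity, zLink], fun i => ?_⟩
        simp only [rowParity, zLink]
        by_cases hi : i = k
        · simpa [hi] using (sum_ite_link a fun _ => (1 : ZMod 2)).trans (by decide)
        · simp [hi]
    | zero => simp [colParity, rowParity]
    | add x y _ _ hx hy =>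
      simp only [colParity, rowParity] at hx hy
      simp [colParity, rowParity, Finset.sum_add_distrib, hx, hy]
    | smul c x _ hx =>
      simp only [colParity, rowParity] at hx
      simp [colParity, rowParity, ← Finset.mul_sum, hx]
  · rintro ⟨hc, hr⟩
    rw [eq_sum_single e]
    refine Submodule.add_mem _ (Submodule.sum_mem _ fun j _ => ?_)
      (Submodule.sum_mem _ fun i _ => ?_)
    · refine sum_smul_mem_of_links _ _ (fun a => ?_) _ (hc j)
      rw [← xLink_eq]
      exact Submodule.subset_span (Or.inl ⟨(a, j), rfl⟩)
    · refine sum_smul_mem_of_links _ _ (fun a => ?_) _ (hr i)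
      rw [← zLink_eq]
      exact Submodule.subset_span (Or.inr ⟨(i, a), rfl⟩)

lemma stab_le_gauge (n : ℕ) : stab n ≤ gauge n := by
  rw [stab, Submodule.span_le]
  rintro _ (⟨a, rfl⟩ | ⟨a, rfl⟩) <;> refine (mem_gauge_iff _).2 ⟨fun j => ?_, fun i => ?_⟩
  · simp [colParity, zCol]
  · exact (sum_ite_link a fun _ => (1 : ZMod 2)).trans (by decide)
  · exact (sum_ite_link a fun _ => (1 : ZMod 2)).trans (by decide)
  · simp [rowParity, xRow]

lemma omg_eq_zero_of_mem_stab_of_mem_gauge {n : ℕ} {s g : PV n} (hs : s ∈ stab n)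
    (hg : g ∈ gauge n) : omg s g = 0 := by
  obtain ⟨hc, hr⟩ := (mem_gauge_iff g).1 hg
  rw [omg_comm]
  exact (forall_mem_stab_omg_eq_zero_iff g).2 ⟨by simp [hc], by simp [hr]⟩ s hs

/-- A dressed logical operator meets every column or every row, so has weight at least `n`. -/
lemma le_wt_of_notMem_gauge {n : ℕ} {e : PV n} (he : ∀ s ∈ stab n, omg e s = 0)
    (hg : e ∉ gauge n) : n ≤ wt e := by
  obtain ⟨hc, hr⟩ := (forall_mem_stab_omg_eq_zero_iff e).1 he
  have surj_card (f : Fin n × Fin n → Fin n)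
      (h : ∀ k, ∃ q, (e.1 q ≠ 0 ∨ e.2 q ≠ 0) ∧ f q = k) : n ≤ wt e := by
    calc n = (Finset.univ : Finset (Fin n)).card := by simp
      _ ≤ wt e := Finset.card_le_card_of_surjOn f fun k _ => by simpa using h k
  rw [mem_gauge_iff, not_and_or, not_forall, not_forall] at hg
  rcases hg with ⟨k, hk⟩ | ⟨k, hk⟩
  · refine surj_card Prod.snd fun j => ?_
    rw [hc k j] at hk
    obtain ⟨i, -, hi⟩ := Finset.exists_ne_zero_of_sum_ne_zero hk
    exact ⟨(i, j), Or.inl hi, rfl⟩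
  · refine surj_card Prod.fst fun i => ?_
    rw [hr k i] at hk
    obtain ⟨j, -, hj⟩ := Finset.exists_ne_zero_of_sum_ne_zero hk
    exact ⟨(i, j), Or.inr hj, rfl⟩

lemma colParity_singleCol {n : ℕ} (j₀ j : Fin n) : colParity (singleCol n j₀) j = 0 := by
  simp [colParity, singleCol]

lemma rowParity_singleCol {n : ℕ} (j₀ i : Fin n) : rowParity (singleCol n j₀) i = 1 := by
  simp [rowParity, singleCol]

lemma omg_singleCol_eq_zero {n : ℕ} (j₀ : Fin n) : ∀ s ∈ stab n, omg (singleCol n j₀) s = 0 :=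
  (forall_mem_stab_omg_eq_zero_iff _).2
    ⟨by simp [colParity_singleCol], by simp [rowParity_singleCol]⟩

lemma singleCol_notMem_gauge {n : ℕ} (j₀ : Fin n) : singleCol n j₀ ∉ gauge n := by
  rw [mem_gauge_iff]
  rintro ⟨-, hr⟩
  exact one_ne_zero ((rowParity_singleCol j₀ j₀).symm.trans (hr j₀))

lemma wt_singleCol {n : ℕ} (j₀ : Fin n) : wt (singleCol n j₀) = n := by
  have : (Finset.univ.filter fun q : Fin n × Fin n => q.2 = j₀) = Finset.univ ×ˢ {j₀} := by
    ext q
    rw [Finset.mem_filter, Finset.mem_product]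
    simp
  simp [wt, singleCol, this]

/-- The Bacon–Shor code is an `[[n²,1,n]]` subsystem code: (a) the stabilizer checks lie
in the gauge span and are ω-orthogonal to every gauge element (they are products of gauge
links lying in the center of the gauge group); (b) the minimum weight of an element of
`S^⊥ \ g` equals `n`; in particular every single-column Z-type vector lies in `S^⊥ \ g`
and has weight `n`. -/
theorem bacon_shor_subsystem_code (n : ℕ) (hn : 2 ≤ n) :
    (stab n ≤ gauge n ∧ ∀ s ∈ stab n, ∀ g ∈ gauge n, omg s g = 0) ∧
    IsLeast {w : ℕ | ∃ e : PV n, (∀ s ∈ stab n, omg e s = 0) ∧ e ∉ gauge n ∧ wt e = w} n ∧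
    (∀ j₀ : Fin n,
      (∀ s ∈ stab n, omg (singleCol n j₀) s = 0) ∧
      singleCol n j₀ ∉ gauge n ∧
      wt (singleCol n j₀) = n) := by
  have hcol (j₀ : Fin n) := And.intro (omg_singleCol_eq_zero j₀)
    (And.intro (singleCol_notMem_gauge j₀) (wt_singleCol j₀))
  refine ⟨⟨stab_le_gauge n, fun s hs g hg => omg_eq_zero_of_mem_stab_of_mem_gauge hs hg⟩,
    ⟨⟨_, hcol ⟨0, by omega⟩⟩, ?_⟩, hcol⟩
  rintro _ ⟨e, he, hg, rfl⟩
  exact le_wt_of_notMem_gauge he hg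

end QEC19
end
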